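/- Fix a real number u. As x → ∞, (1/x)·#{n : 1 < n ≤ x and ω(β(n)) − log log x ≤ u·√(log log x)} tends to (1/√(2π)) ∫_{−∞}^{u} e^{−t²/2} dt. -/

import Mathlib

open Filter

namespace ErdosKac

open Finset Real

/-! ### The theorems of Mertens -/

lemma log_factorial_eq (N : ℕ) :
    log (N.factorial : ℝ) = ∑ p ∈ Nat.primesLE N, (padicValNat p N.factorial : ℝ) * log p := by
  rw [Real.log_nat_eq_sum_factorization, Finsupp.sum]
  refine Finset.sum_subset_zero_on_sdiff ?_ ?_ ?_
  · intro p hp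
    rw [Nat.support_factorization, Nat.mem_primeFactors] at hp
    exact Nat.mem_primesLE.2 ⟨(hp.1.dvd_factorial).1 hp.2.1, hp.1⟩
  · intro p hp
    rw [Finset.mem_sdiff] at hp
    have h1 := (Nat.mem_primesLE.1 hp.1).2
    rw [← Nat.factorization_def _ h1, Finsupp.notMem_support_iff.1 hp.2]
    simp
  · intro p hp
    rw [Nat.support_factorization, Nat.mem_primeFactors] at hp
    rw [Nat.factorization_def _ hp.1]

lemma le_padicValNat_factorial {p N : ℕ} (hp : p.Prime) :
    (N : ℝ) / p - 1 ≤ padicValNat p N.factorial := by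
  have h1 : N / p ≤ padicValNat p N.factorial := by
    have := Fact.mk hp
    rw [padicValNat_factorial (Nat.lt_succ_self _)]
    rcases Nat.lt_or_ge N p with h | h
    · rw [Nat.div_eq_of_lt h]; exact Nat.zero_le _
    · have : 1 ∈ Finset.Ico 1 (Nat.log p N).succ := by
        rw [Finset.mem_Ico]
        exact ⟨le_refl _, Nat.lt_succ_of_le (Nat.log_pos hp.one_lt h)⟩
      have h2 := Finset.single_le_sum (f := fun i => N / p ^ i) (fun i _ => Nat.zero_le _) this
      simpa using h2
  have h2 : ((N / p : ℕ) : ℝ) ≤ padicValNat p N.factorial := by exact_mod_cast h1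
  have h3 := Nat.lt_floor_add_one ((N : ℝ) / p)
  rw [Nat.floor_div_eq_div] at h3
  linarith

lemma padicValNat_factorial_le {p N : ℕ} (hp : p.Prime) :
    (padicValNat p N.factorial : ℝ) ≤ N / (p - 1) := by
  have := Fact.mk hp
  have h := sub_one_mul_padicValNat_factorial (p := p) N
  have h1 : (p - 1) * padicValNat p N.factorial ≤ N := by rw [h]; exact Nat.sub_le _ _
  have h2 : ((p - 1 : ℕ) : ℝ) * padicValNat p N.factorial ≤ N := by exact_mod_cast h1
  rw [Nat.cast_sub hp.one_le, Nat.cast_one] at h2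
  have : (1 : ℝ) < p := by exact_mod_cast hp.one_lt
  rw [le_div_iff₀ (by linarith)]
  linarith

lemma log_factorial_le (N : ℕ) : log (N.factorial : ℝ) ≤ N * log N := by
  rw [← Real.log_pow]
  apply Real.log_le_log (by exact_mod_cast N.factorial_pos)
  exact_mod_cast Nat.factorial_le_pow N

lemma le_log_factorial {N : ℕ} (hN : 1 ≤ N) : N * log N - N ≤ log (N.factorial : ℝ) := by
  have h := Real.pow_div_factorial_le_exp (N : ℝ) (by positivity) N
  have hf : (0 : ℝ) < N.factorial := by exact_mod_cast N.factorial_pos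
  have hN' : (0 : ℝ) < N := by exact_mod_cast hN
  have h2 := Real.log_le_log (by positivity) h
  rw [Real.log_exp, Real.log_div (by positivity) (by positivity), Real.log_pow] at h2
  linarith

lemma sum_log_div_mul_pred_le (N : ℕ) :
    ∑ k ∈ Ioc 1 (N + 1), log k / (k * (k - 1)) ≤ 2 - (log (N + 1) + 2) / (N + 1) := by
  induction N with
  | zero => simp
  | succ n ih =>
    rw [Finset.sum_Ioc_succ_top (by omega)]
    refine (add_le_add_left ih _).trans ?_
    push_cast
    have hn : (0 : ℝ) < (n : ℝ) + 1 := by positivity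
    set m : ℝ := (n : ℝ) + 1
    have hm1 : 1 ≤ m := by simp [m]
    have hlog : log (m + 1) - log m ≤ 1 / m := by
      rw [← Real.log_div (by positivity) (by positivity)]
      refine (Real.log_le_sub_one_of_pos (by positivity)).trans (le_of_eq ?_)
      field_simp
      ring
    have hkey : log (m + 1) / ((m + 1) * (m + 1 - 1)) ≤
        (log m + 2) / m - (log (m + 1) + 2) / (m + 1) := by
      rw [div_sub_div _ _ (by positivity) (by positivity), add_sub_cancel_right,
        mul_comm m (m + 1)]
      apply div_le_div_of_nonneg_right _ (by positivity)
      have h1 : (m + 1) * (log (m + 1) - log m) ≤ (m + 1) * (1 / m) :=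
        mul_le_mul_of_nonneg_left hlog (by positivity)
      have h2 : (m + 1) * (1 / m) ≤ 2 := by
        rw [mul_one_div, div_le_iff₀ (by positivity)]; linarith
      linarith
    linarith

lemma sum_log_div_primes_le {N : ℕ} (hN : 1 ≤ N) :
    ∑ p ∈ Nat.primesLE N, log p / p ≤ log N + 2 := by
  have hN' : (0 : ℝ) < N := by exact_mod_cast hN
  have h1 : ∑ p ∈ Nat.primesLE N, ((N : ℝ) / p - 1) * log p ≤ N * log N := by
    refine le_trans (Finset.sum_le_sum fun p hp => ?_)
      ((log_factorial_eq N).symm.le.trans (log_factorial_le N))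
    exact mul_le_mul_of_nonneg_right (le_padicValNat_factorial (Nat.mem_primesLE.1 hp).2)
      (Real.log_natCast_nonneg _)
  have h2 : ∑ p ∈ Nat.primesLE N, ((N : ℝ) / p - 1) * log p =
      N * ∑ p ∈ Nat.primesLE N, log p / p - Chebyshev.theta N := by
    rw [Chebyshev.theta_eq_sum_primesLE_log, Finset.mul_sum, ← Finset.sum_sub_distrib]
    refine Finset.sum_congr rfl fun p _ => ?_
    ring
  have h3 := Chebyshev.theta_le_log4_mul_x (x := (N : ℝ)) hN'.le
  have h4 : log 4 ≤ 2 := by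
    have : (4 : ℝ) = 2 ^ 2 := by norm_num
    rw [this, Real.log_pow]
    have := Real.log_two_lt_d9
    push_cast
    linarith
  have h5 : N * ∑ p ∈ Nat.primesLE N, log p / p ≤ N * (log N + 2) := by nlinarith
  exact le_of_mul_le_mul_left h5 hN'

lemma le_sum_log_div_primes {N : ℕ} (hN : 1 ≤ N) :
    log N - 3 ≤ ∑ p ∈ Nat.primesLE N, log p / p := by
  have hN' : (0 : ℝ) < N := by exact_mod_cast hN
  have h1 : N * log N - N ≤ ∑ p ∈ Nat.primesLE N, (N : ℝ) / (p - 1) * log p := by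
    refine (le_log_factorial hN).trans ((log_factorial_eq N).le.trans
      (Finset.sum_le_sum fun p hp => ?_))
    exact mul_le_mul_of_nonneg_right (padicValNat_factorial_le (Nat.mem_primesLE.1 hp).2)
      (Real.log_natCast_nonneg _)
  have h2 : ∑ p ∈ Nat.primesLE N, (N : ℝ) / (p - 1) * log p =
      N * (∑ p ∈ Nat.primesLE N, log p / p + ∑ p ∈ Nat.primesLE N, log p / (p * (p - 1))) := by
    rw [← Finset.sum_add_distrib, Finset.mul_sum]
    refine Finset.sum_congr rfl fun p hp => ?_
    have : (1 : ℝ) < p := by exact_mod_cast (Nat.mem_primesLE.1 hp).2.one_lt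
    have h : (p : ℝ) - 1 ≠ 0 := by linarith
    field_simp
    ring
  have h3 : ∑ p ∈ Nat.primesLE N, log p / ((p : ℝ) * (p - 1)) ≤ 2 := by
    have hsub : Nat.primesLE N ⊆ Ioc 1 (N + 1) := by
      intro p hp
      rw [Nat.mem_primesLE] at hp
      rw [Finset.mem_Ioc]
      exact ⟨hp.2.one_lt, by omega⟩
    refine (Finset.sum_le_sum_of_subset_of_nonneg hsub fun k hk _ => ?_).trans
      ((sum_log_div_mul_pred_le N).trans ?_)
    · have : (1 : ℝ) < k := by exact_mod_cast (Finset.mem_Ioc.1 hk).1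
      exact div_nonneg (Real.log_natCast_nonneg _) (mul_nonneg (by linarith) (by linarith))
    · have : 0 ≤ log ((N : ℝ) + 1) := Real.log_nonneg (by linarith)
      have : 0 ≤ (log ((N : ℝ) + 1) + 2) / (N + 1) := by positivity
      linarith
  rw [h2] at h1
  have h5 : N * (log N - 1) ≤
      N * (∑ p ∈ Nat.primesLE N, log p / p + ∑ p ∈ Nat.primesLE N, log p / (p * (p - 1))) := by
    linarith
  have := le_of_mul_le_mul_left h5 hN'
  linarith

lemma abs_sum_mul_le_of_antitone {f g : ℕ → ℝ} {C : ℝ} {m n : ℕ} (hmn : m < n)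
    (hf : ∀ k, m < k → 0 ≤ f k) (hanti : ∀ k, m < k → f (k + 1) ≤ f k)
    (hg : ∀ k, |∑ i ∈ range k, g i| ≤ C) :
    |∑ k ∈ Ioc m n, f k * g k| ≤ 2 * C * f (m + 1) := by
  have h := Finset.sum_Ioc_by_parts f g hmn
  simp only [smul_eq_mul] at h
  rw [h]
  have h1 : |f n * ∑ i ∈ range (n + 1), g i| ≤ f n * C := by
    rw [abs_mul, abs_of_nonneg (hf n hmn)]
    exact mul_le_mul_of_nonneg_left (hg _) (hf n hmn)
  have h2 : |f (m + 1) * ∑ i ∈ range (m + 1), g i| ≤ f (m + 1) * C := by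
    rw [abs_mul, abs_of_nonneg (hf _ (Nat.lt_succ_self m))]
    exact mul_le_mul_of_nonneg_left (hg _) (hf _ (Nat.lt_succ_self m))
  have h3 : |∑ i ∈ Ioc m (n - 1), (f (i + 1) - f i) * ∑ j ∈ range (i + 1), g j| ≤
      (f (m + 1) - f n) * C := by
    refine (Finset.abs_sum_le_sum_abs _ _).trans ?_
    have h4 : ∑ i ∈ Ioc m (n - 1), |(f (i + 1) - f i) * ∑ j ∈ range (i + 1), g j| ≤
        ∑ i ∈ Ioc m (n - 1), (f i - f (i + 1)) * C := by
      refine Finset.sum_le_sum fun i hi => ?_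
      have hi' := (Finset.mem_Ioc.1 hi).1
      rw [abs_mul, abs_sub_comm, abs_of_nonneg (sub_nonneg.2 (hanti i hi'))]
      exact mul_le_mul_of_nonneg_left (hg _) (sub_nonneg.2 (hanti i hi'))
    refine h4.trans (le_of_eq ?_)
    rw [← Finset.sum_mul]
    congr 1
    have : Ioc m (n - 1) = Ico (m + 1) n := by
      ext i; simp only [Finset.mem_Ioc, Finset.mem_Ico]; omega
    rw [this]
    have h5 := Finset.sum_Ico_sub f (show m + 1 ≤ n from hmn)
    have h6 : ∑ i ∈ Ico (m + 1) n, (f i - f (i + 1)) = -∑ i ∈ Ico (m + 1) n, (f (i + 1) - f i) := by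
      rw [← Finset.sum_neg_distrib]
      exact Finset.sum_congr rfl fun _ _ => by ring
    rw [h6, h5]; ring
  have := abs_sub (f n * ∑ i ∈ range (n + 1), g i - f (m + 1) * ∑ i ∈ range (m + 1), g i)
    (∑ i ∈ Ioc m (n - 1), (f (i + 1) - f i) * ∑ j ∈ range (i + 1), g j)
  have h8 := abs_sub (f n * ∑ i ∈ range (n + 1), g i) (f (m + 1) * ∑ i ∈ range (m + 1), g i)
  linarith

/-- The terms `(log k - log (k - 1)) / log k` are a good approximation to the increments of
`log log`. -/
lemma abs_sum_log_sub_div_log_sub_le (n : ℕ) :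
    |∑ k ∈ Ioc 2 (n + 2), (log k)⁻¹ * (log k - log (k - 1 : ℕ)) -
      (log (log (n + 2 : ℕ)) - log (log 2))| ≤ (log 2)⁻¹ - (log (n + 2 : ℕ))⁻¹ := by
  induction n with
  | zero => simp
  | succ n ih =>
    rw [Finset.sum_Ioc_succ_top (by omega)]
    have e : n + 1 + 2 - 1 = n + 2 := by omega
    rw [e]
    set a := log ((n + 2 : ℕ) : ℝ)
    set b := log ((n + 1 + 2 : ℕ) : ℝ)
    have ha : 0 < a := Real.log_pos (by push_cast; linarith [(Nat.cast_nonneg n : (0:ℝ) ≤ n)])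
    have hab : a ≤ b := Real.log_le_log (by positivity) (by push_cast; linarith)
    have hb : 0 < b := ha.trans_le hab
    have hba : b - a ≤ 1 := by
      rw [← Real.log_div (by positivity) (by positivity)]
      refine (Real.log_le_sub_one_of_pos (by positivity)).trans ?_
      rw [sub_le_iff_le_add, div_le_iff₀ (by positivity)]
      push_cast; linarith [(Nat.cast_nonneg n : (0:ℝ) ≤ n)]
    have hu : log b - log a ≤ (b - a) / a := by
      rw [← Real.log_div (by positivity) (by positivity)]
      refine (Real.log_le_sub_one_of_pos (by positivity)).trans (le_of_eq ?_)
      field_simp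
    have hl : (b - a) / b ≤ log b - log a := by
      have h1 : log a - log b ≤ (a - b) / b := by
        rw [← Real.log_div (by positivity) (by positivity)]
        refine (Real.log_le_sub_one_of_pos (by positivity)).trans (le_of_eq ?_)
        field_simp
      have : (b - a) / b = - ((a - b) / b) := by ring
      linarith
    have hd : (b - a) / a - (b - a) / b ≤ a⁻¹ - b⁻¹ := by
      have h0 : 0 ≤ a⁻¹ - b⁻¹ := sub_nonneg.2 (inv_anti₀ ha hab)
      have : (b - a) / a - (b - a) / b = (b - a) * (a⁻¹ - b⁻¹) := by ring
      rw [this]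
      exact (mul_le_mul_of_nonneg_right hba h0).trans (by rw [one_mul])
    have e2 : b⁻¹ * (b - a) = (b - a) / b := by ring
    rw [e2]
    rw [abs_le] at ih ⊢
    constructor <;> linarith

/-- Mertens' second theorem with bounded error, for natural numbers. -/
lemma exists_abs_sum_inv_primesLE_sub_le :
    ∃ C : ℝ, ∀ N : ℕ, 2 ≤ N → |∑ p ∈ Nat.primesLE N, (p : ℝ)⁻¹ - log (log N)| ≤ C := by
  refine ⟨6 * (log 3)⁻¹ + (log 2)⁻¹ + |log (log 2)| + 1, fun N hN => ?_⟩
  set g : ℕ → ℝ := fun k => (if k.Prime then log k / k else 0) - (log k - log (k - 1 : ℕ))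
  have hg : ∀ k, |∑ i ∈ range k, g i| ≤ 3 := by
    intro k
    rcases k with _ | n
    · simp
    · have h1 : ∑ i ∈ range (n + 1), g i = ∑ p ∈ Nat.primesLE n, log p / p - log n := by
        simp only [g]
        rw [Finset.sum_sub_distrib, ← Finset.sum_filter, ← Nat.primesLE_eq_filter_range,
          Finset.sum_range_succ']
        congr 1
        simp only [add_tsub_cancel_right]
        rw [Finset.sum_range_sub (fun i : ℕ => log (i : ℝ))]
        simp
      rw [h1]
      rcases Nat.eq_zero_or_pos n with rfl | hn
      · simp
      · have h2 := sum_log_div_primes_le hn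
        have h3 := le_sum_log_div_primes hn
        rw [abs_le]; constructor <;> linarith
  have hsplit : ∑ p ∈ Nat.primesLE N, (p : ℝ)⁻¹ = 2⁻¹ + ∑ k ∈ Ioc 2 N, (log k)⁻¹ * g k +
      ∑ k ∈ Ioc 2 N, (log k)⁻¹ * (log k - log (k - 1 : ℕ)) := by
    rw [Nat.primesLE_eq_filter_Icc_two, Finset.sum_filter, ← Finset.sum_Ioc_add_eq_sum_Icc hN,
      if_pos Nat.prime_two, add_assoc, ← Finset.sum_add_distrib, add_comm]
    congr 1
    refine Finset.sum_congr rfl fun k hk => ?_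
    have hk2 : (2 : ℝ) < k := by exact_mod_cast (Finset.mem_Ioc.1 hk).1
    have : 0 < log (k : ℝ) := Real.log_pos (by linarith)
    simp only [g]
    split_ifs
    · field_simp; ring
    · ring
  obtain ⟨n, rfl⟩ := Nat.exists_eq_add_of_le' hN
  have hS2 := abs_sum_log_sub_div_log_sub_le n
  have hS1 : |∑ k ∈ Ioc 2 (n + 2), (log k)⁻¹ * g k| ≤ 6 * (log 3)⁻¹ := by
    have hl3 : 0 < log (3 : ℝ) := Real.log_pos (by norm_num)
    rcases Nat.eq_zero_or_pos n with rfl | hn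
    · simp; positivity
    · have := abs_sum_mul_le_of_antitone (f := fun k : ℕ => (log (k : ℝ))⁻¹) (m := 2) (n := n + 2)
        (by omega) (fun k hk => inv_nonneg.2 (Real.log_natCast_nonneg k)) (fun k hk => ?_) hg
      · refine this.trans (le_of_eq ?_)
        norm_num
      · have hk' : (2 : ℝ) < k := by exact_mod_cast hk
        exact inv_anti₀ (Real.log_pos (by linarith))
          (Real.log_le_log (by linarith) (by push_cast; linarith))
  have h0 : 0 ≤ (log ((n + 2 : ℕ) : ℝ))⁻¹ := inv_nonneg.2 (Real.log_natCast_nonneg _)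
  rw [hsplit]
  rw [abs_le] at hS1 hS2 ⊢
  have h7 := neg_abs_le (log (log 2))
  have h8 := le_abs_self (log (log 2))
  constructor <;> linarith

/-- The primes in the half-open interval `(a, b]`. -/
noncomputable def primesIoc (a b : ℝ) : Finset ℕ := (Finset.Ioc ⌊a⌋₊ ⌊b⌋₊).filter Nat.Prime

lemma mem_primesIoc {a b : ℝ} (ha : 0 ≤ a) (hb : 0 ≤ b) {p : ℕ} :
    p ∈ primesIoc a b ↔ p.Prime ∧ a < p ∧ (p : ℝ) ≤ b := by
  rw [primesIoc, Finset.mem_filter, Finset.mem_Ioc, Nat.floor_lt ha, Nat.le_floor_iff hb]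
  tauto

/-- Mertens' second theorem with bounded error, on intervals. -/
theorem exists_abs_sum_inv_primesIoc_sub_le :
    ∃ C : ℝ, 0 < C ∧ ∀ a b : ℝ, 2 ≤ a → a ≤ b →
      |∑ p ∈ primesIoc a b, (p : ℝ)⁻¹ - (log (log b) - log (log a))| ≤ C := by
  obtain ⟨C, hC⟩ := exists_abs_sum_inv_primesLE_sub_le
  have key : ∀ x : ℝ, 2 ≤ x →
      |∑ p ∈ Nat.primesLE ⌊x⌋₊, (p : ℝ)⁻¹ - log (log x)| ≤ C + (log 2)⁻¹ := by
    intro x hx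
    have hN : 2 ≤ ⌊x⌋₊ := Nat.le_floor (by exact_mod_cast hx)
    have h1 := hC _ hN
    have hN' : (2 : ℝ) ≤ (⌊x⌋₊ : ℝ) := by exact_mod_cast hN
    have hle : (⌊x⌋₊ : ℝ) ≤ x := Nat.floor_le (by linarith)
    have hlt : x < ⌊x⌋₊ + 1 := Nat.lt_floor_add_one x
    set m : ℝ := (⌊x⌋₊ : ℝ)
    have hl2 : 0 < log 2 := Real.log_pos (by norm_num)
    have hm2 : log 2 ≤ log m := Real.log_le_log (by norm_num) hN'
    have hmx : log m ≤ log x := Real.log_le_log (by linarith) hle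
    have hd : log x - log m ≤ 1 := by
      rw [← Real.log_div (by linarith) (by linarith)]
      refine (Real.log_le_sub_one_of_pos (div_pos (by linarith) (by linarith))).trans ?_
      rw [sub_le_iff_le_add, div_le_iff₀ (by linarith)]
      linarith
    have h2 : log (log m) ≤ log (log x) := Real.log_le_log (by linarith) hmx
    have h3 : log (log x) - log (log m) ≤ (log 2)⁻¹ := by
      rw [← Real.log_div (by linarith) (by linarith)]
      refine (Real.log_le_sub_one_of_pos (div_pos (by linarith) (by linarith))).trans ?_
      have : log x / log m - 1 = (log x - log m) / log m := by
        rw [sub_div, div_self (by linarith)]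
      rw [this, ← one_div]
      exact div_le_div₀ zero_le_one hd hl2 hm2
    rw [abs_le] at h1 ⊢
    have : 0 < (log 2)⁻¹ := by positivity
    constructor <;> linarith
  have hl2 : 0 < log 2 := Real.log_pos (by norm_num)
  have hCpos : 0 ≤ C := (abs_nonneg _).trans (hC 2 le_rfl)
  refine ⟨2 * (C + (log 2)⁻¹), by positivity, fun a b ha hab => ?_⟩
  have hs : ∑ p ∈ primesIoc a b, (p : ℝ)⁻¹ =
      ∑ p ∈ Nat.primesLE ⌊b⌋₊, (p : ℝ)⁻¹ - ∑ p ∈ Nat.primesLE ⌊a⌋₊, (p : ℝ)⁻¹ := by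
    rw [primesIoc, Nat.primesLE_eq_filter_Ioc_zero, Nat.primesLE_eq_filter_Ioc_zero,
      Finset.sum_filter, Finset.sum_filter, Finset.sum_filter, eq_sub_iff_add_eq, add_comm,
      Finset.sum_Ioc_consecutive _ (Nat.zero_le _) (Nat.floor_mono hab)]
  have h1 := key a ha
  have h2 := key b (ha.trans hab)
  rw [hs]
  rw [abs_le] at h1 h2 ⊢
  constructor <;> linarith

end ErdosKac

namespace ErdosKac

open Finset Real

/-! ### A large sieve inequality -/

/-- The root of unity `exp (2 π i r)`. -/
noncomputable def zeta (r : ℚ) : ℂ := Complex.exp (2 * π * Complex.I * r)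

lemma norm_zeta (r : ℚ) : ‖zeta r‖ = 1 := by
  rw [zeta, Complex.norm_exp]
  simp

lemma zeta_pow_eq_one {r : ℚ} {m : ℕ} {k : ℤ} (h : r * m = k) : zeta r ^ m = 1 := by
  rw [zeta, ← Complex.exp_nat_mul, Complex.exp_eq_one_iff]
  refine ⟨k, ?_⟩
  have h' : (r : ℂ) * m = k := by exact_mod_cast congrArg (fun q : ℚ => (q : ℂ)) h
  rw [← h']; ring

lemma zeta_sub (r s : ℚ) : zeta (r - s) = zeta r * (starRingEnd ℂ) (zeta s) := by
  simp only [zeta]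
  rw [← Complex.exp_conj, ← Complex.exp_add]
  congr 1
  simp [Complex.conj_ofNat]
  ring

lemma zeta_ne_one {r : ℚ} (h0 : r ≠ 0) (h1 : |r| < 1) : zeta r ≠ 1 := by
  intro h
  rw [zeta, Complex.exp_eq_one_iff] at h
  obtain ⟨n, hn⟩ := h
  have hpi : (2 * π * Complex.I : ℂ) ≠ 0 := Complex.two_pi_I_ne_zero
  have h2 : (r : ℂ) = n := by
    rw [mul_comm] at hn
    exact mul_right_cancel₀ hpi hn
  have h3 : r = n := by exact_mod_cast h2
  rw [h3] at h1 h0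
  have h4 : |n| < 1 := by exact_mod_cast h1
  exact h0 (by rw [Int.abs_lt_one_iff.1 h4]; simp)

lemma norm_geom_sum_le {z : ℂ} {m : ℕ} (hm : 0 < m) (hz : z ^ m = 1) (hz1 : z ≠ 1) (N : ℕ) :
    ‖∑ n ∈ range N, z ^ n‖ ≤ m := by
  have hnorm : ‖z‖ = 1 := Complex.norm_eq_one_of_pow_eq_one hz hm.ne'
  have hN : z ^ N = z ^ (N % m) := by
    conv_lhs => rw [← Nat.div_add_mod N m]
    rw [pow_add, pow_mul, hz, one_pow, one_mul]
  have h : ∑ n ∈ range N, z ^ n = ∑ n ∈ range (N % m), z ^ n := by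
    rw [geom_sum_eq hz1, geom_sum_eq hz1, hN]
  rw [h]
  refine (norm_sum_le _ _).trans ?_
  simp only [norm_pow, hnorm, one_pow, sum_const, card_range, nsmul_eq_mul, mul_one]
  exact_mod_cast (Nat.mod_lt N hm).le

section LargeSieve

variable {D : ℕ} {R : Finset ℚ}

lemma norm_geom_sum_zeta_le (hR : ∀ r ∈ R, 0 < r ∧ r < 1 ∧ r.den ≤ D) {r s : ℚ} (hr : r ∈ R)
    (hs : s ∈ R) (hrs : r ≠ s) (N : ℕ) :
    ‖∑ n ∈ range N, (zeta r * (starRingEnd ℂ) (zeta s)) ^ n‖ ≤ (D : ℝ) ^ 2 := by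
  obtain ⟨hr0, hr1, hrD⟩ := hR r hr
  obtain ⟨hs0, hs1, hsD⟩ := hR s hs
  rw [← zeta_sub]
  have h1 : zeta (r - s) ^ (r.den * s.den) = 1 := by
    refine zeta_pow_eq_one (k := r.num * s.den - s.num * r.den) ?_
    have e1 := Rat.mul_den_eq_num r
    have e2 := Rat.mul_den_eq_num s
    push_cast
    rw [← e1, ← e2]; ring
  have h2 : zeta (r - s) ≠ 1 :=
    zeta_ne_one (sub_ne_zero.2 hrs) (abs_lt.2 ⟨by linarith, by linarith⟩)
  refine (norm_geom_sum_le (Nat.mul_pos r.den_pos s.den_pos) h1 h2 N).trans ?_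
  rw [sq]
  exact_mod_cast Nat.mul_le_mul hrD hsD

lemma large_sieve_dual (hR : ∀ r ∈ R, 0 < r ∧ r < 1 ∧ r.den ≤ D) (b : ℚ → ℂ) (N : ℕ) :
    ∑ n ∈ range N, ‖∑ r ∈ R, b r * zeta r ^ n‖ ^ 2 ≤
      (N + D ^ 2 * #R) * ∑ r ∈ R, ‖b r‖ ^ 2 := by
  have h1 : ((∑ n ∈ range N, ‖∑ r ∈ R, b r * zeta r ^ n‖ ^ 2 : ℝ) : ℂ) =
      ∑ r ∈ R, ∑ s ∈ R, b r * (starRingEnd ℂ) (b s) *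
        ∑ n ∈ range N, (zeta r * (starRingEnd ℂ) (zeta s)) ^ n := by
    push_cast
    simp_rw [← Complex.mul_conj', map_sum, Finset.sum_mul_sum, Finset.mul_sum]
    rw [Finset.sum_comm]
    refine Finset.sum_congr rfl fun r _ => ?_
    rw [Finset.sum_comm]
    refine Finset.sum_congr rfl fun s _ => Finset.sum_congr rfl fun n _ => ?_
    rw [map_mul, map_pow, mul_pow]
    ring
  have h2 : ∑ n ∈ range N, ‖∑ r ∈ R, b r * zeta r ^ n‖ ^ 2 ≤
      ∑ r ∈ R, ∑ s ∈ R, (‖b r‖ * ‖b s‖ * D ^ 2 + if r = s then N * ‖b r‖ ^ 2 else 0) := by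
    have h3 : ∑ n ∈ range N, ‖∑ r ∈ R, b r * zeta r ^ n‖ ^ 2 =
        ‖((∑ n ∈ range N, ‖∑ r ∈ R, b r * zeta r ^ n‖ ^ 2 : ℝ) : ℂ)‖ := by
      rw [Complex.norm_real, Real.norm_of_nonneg (by positivity)]
    rw [h3, h1]
    refine (norm_sum_le _ _).trans (Finset.sum_le_sum fun r hr => ?_)
    refine (norm_sum_le _ _).trans (Finset.sum_le_sum fun s hs => ?_)
    rw [norm_mul, norm_mul, RCLike.norm_conj]
    split_ifs with h
    · subst h
      have : ‖∑ n ∈ range N, (zeta r * (starRingEnd ℂ) (zeta r)) ^ n‖ ≤ N := by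
        refine (norm_sum_le _ _).trans ?_
        simp [norm_zeta]
      have h4 := mul_le_mul_of_nonneg_left this
        (mul_nonneg (norm_nonneg (b r)) (norm_nonneg (b r)))
      have : 0 ≤ ‖b r‖ * ‖b r‖ * (D : ℝ) ^ 2 := by positivity
      nlinarith
    · rw [add_zero]
      exact mul_le_mul_of_nonneg_left (norm_geom_sum_zeta_le hR hr hs h N) (by positivity)
  refine h2.trans ?_
  simp_rw [Finset.sum_add_distrib, ← Finset.sum_mul, ← Finset.sum_mul_sum]
  have h5 : ∑ r ∈ R, ∑ s ∈ R, (if r = s then N * ‖b r‖ ^ 2 else 0) =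
      N * ∑ r ∈ R, ‖b r‖ ^ 2 := by
    rw [Finset.mul_sum]
    exact Finset.sum_congr rfl fun r hr => by rw [Finset.sum_ite_eq, if_pos hr]
  rw [h5]
  have h6 := sq_sum_le_card_mul_sum_sq (s := R) (f := fun r => ‖b r‖)
  have h7 := mul_le_mul_of_nonneg_right h6 (by positivity : (0 : ℝ) ≤ (D : ℝ) ^ 2)
  nlinarith

/-- A weak large sieve inequality for Farey fractions of order `D`. -/
theorem large_sieve (hR : ∀ r ∈ R, 0 < r ∧ r < 1 ∧ r.den ≤ D) (c : ℕ → ℂ) (N : ℕ) :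
    ∑ r ∈ R, ‖∑ n ∈ range N, c n * zeta r ^ n‖ ^ 2 ≤
      (N + D ^ 2 * #R) * ∑ n ∈ range N, ‖c n‖ ^ 2 := by
  set S : ℚ → ℂ := fun r => ∑ n ∈ range N, c n * zeta r ^ n
  set b : ℚ → ℂ := fun r => (starRingEnd ℂ) (S r)
  set A : ℝ := ∑ r ∈ R, ‖S r‖ ^ 2
  have hA0 : 0 ≤ A := by positivity
  have hb : ∑ r ∈ R, ‖b r‖ ^ 2 = A := Finset.sum_congr rfl fun r _ => by
    simp only [b]; rw [RCLike.norm_conj]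
  have h1 : (A : ℂ) = ∑ n ∈ range N, c n * ∑ r ∈ R, b r * zeta r ^ n := by
    simp only [A]
    push_cast
    simp_rw [← Complex.mul_conj', Finset.mul_sum]
    rw [Finset.sum_comm]
    refine Finset.sum_congr rfl fun r _ => ?_
    simp only [S, b]
    rw [Finset.sum_mul]
    exact Finset.sum_congr rfl fun n _ => by ring
  have h2 : A ≤ ∑ n ∈ range N, ‖c n‖ * ‖∑ r ∈ R, b r * zeta r ^ n‖ := by
    have : A = ‖(A : ℂ)‖ := by rw [Complex.norm_real, Real.norm_of_nonneg hA0]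
    rw [this, h1]
    refine (norm_sum_le _ _).trans (Finset.sum_le_sum fun n _ => ?_)
    rw [norm_mul]
  have h3 : A ^ 2 ≤ (∑ n ∈ range N, ‖c n‖ ^ 2) * ((N + D ^ 2 * #R) * A) := by
    refine (pow_le_pow_left₀ hA0 h2 2).trans ((Finset.sum_mul_sq_le_sq_mul_sq _ _ _).trans ?_)
    refine mul_le_mul_of_nonneg_left ?_ (by positivity)
    exact (large_sieve_dual hR b N).trans (by rw [hb])
  rcases hA0.eq_or_lt with h | h
  · rw [← h]; positivity
  · refine le_of_mul_le_mul_right ?_ h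
    calc A * A = A ^ 2 := (sq A).symm
      _ ≤ _ := h3
      _ = _ := by ring

lemma card_le_sq_of_den_le (hR : ∀ r ∈ R, 0 < r ∧ r < 1 ∧ r.den ≤ D) : #R ≤ D ^ 2 := by
  have h : #R ≤ #(range D ×ˢ Icc 1 D) := by
    refine Finset.card_le_card_of_injOn (fun r => (r.num.toNat, r.den)) (fun r hr => ?_) ?_
    · obtain ⟨h0, h1, h2⟩ := hR r hr
      have hlt : r.num < r.den := by
        have := Rat.mul_den_eq_num r
        have hd : (0 : ℚ) < r.den := by exact_mod_cast r.den_pos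
        have : (r.num : ℚ) < r.den := by rw [← this]; nlinarith
        exact_mod_cast this
      have := Rat.num_pos.2 h0
      have := r.den_pos
      simp only [Finset.coe_product, Set.mem_prod, Finset.mem_coe, Finset.mem_range,
        Finset.mem_Icc]
      omega
    · intro r hr s hs hrs
      have h0 := Rat.num_pos.2 (hR r hr).1
      have h0' := Rat.num_pos.2 (hR s hs).1
      simp only [Prod.mk.injEq] at hrs
      exact Rat.ext (by omega) hrs.2
  simpa [sq] using h

end LargeSieve

lemma sum_zeta_div_pow {d : ℕ} (hd : 0 < d) (b : ℕ) :
    ∑ a ∈ range d, zeta ((a : ℚ) / d) ^ b = if d ∣ b then (d : ℂ) else 0 := by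
  have hprim := Complex.isPrimitiveRoot_exp d hd.ne'
  set w : ℂ := Complex.exp (2 * π * Complex.I / d)
  have h1 : ∀ a : ℕ, zeta ((a : ℚ) / d) ^ b = (w ^ b) ^ a := by
    intro a
    have : zeta ((a : ℚ) / d) = w ^ a := by
      simp only [zeta, w]
      rw [← Complex.exp_nat_mul]
      congr 1
      push_cast
      ring
    rw [this, ← pow_mul, ← pow_mul, mul_comm]
  simp_rw [h1]
  split_ifs with h
  · rw [(hprim.pow_eq_one_iff_dvd b).2 h]; simp
  · have hne : w ^ b ≠ 1 := fun h' => h ((hprim.pow_eq_one_iff_dvd b).1 h')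
    rw [geom_sum_eq hne, ← pow_mul, mul_comm, pow_mul, hprim.pow_eq_one, one_pow, sub_self,
      zero_div]

end ErdosKac

namespace ErdosKac

open Finset Real

/-! ### Equidistribution of `f m + p + q` in residue classes, on average over the modulus -/

/-- The index of the multiplicative interval `[exp (i / T), exp ((i + 1) / T))` containing `p`. -/
noncomputable def cell (T : ℝ) (p : ℕ) : ℕ := ⌊T * log p⌋₊

lemma lt_exp_cell {T : ℝ} (hT : 0 < T) {p : ℕ} (hp : 0 < p) :
    (p : ℝ) < exp ((cell T p + 1) / T) := by
  have hp' : (0 : ℝ) < p := by exact_mod_cast hp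
  rw [← Real.log_lt_iff_lt_exp hp', lt_div_iff₀ hT, mul_comm]
  exact Nat.lt_floor_add_one _

lemma exp_cell_le {T : ℝ} (hT : 0 < T) {p : ℕ} (hp : 0 < p) :
    exp (cell T p / T) ≤ (p : ℝ) := by
  have hp' : (0 : ℝ) < p := by exact_mod_cast hp
  rw [← Real.le_log_iff_exp_le hp', div_le_iff₀ hT, mul_comm]
  exact Nat.floor_le (mul_nonneg hT.le (Real.log_natCast_nonneg p))

/-- The triples `(m, p, q)` with `p, q ∈ I` such that `m * p' * q' ≤ x` whenever `p'` and `q'` lie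
in the same cells as `p` and `q`. -/
noncomputable def triples (x T : ℝ) (I : Finset ℕ) : Finset (ℕ × ℕ × ℕ) :=
  (Icc 1 ⌊x⌋₊ ×ˢ I ×ˢ I).filter fun t =>
    t.1 * exp ((cell T t.2.1 + 1) / T) * exp ((cell T t.2.2 + 1) / T) ≤ x

/-- The value attached to a triple. -/
def tripleVal (f : ℕ → ℕ) (t : ℕ × ℕ × ℕ) : ℕ := f t.1 + t.2.1 + t.2.2

/-- The exponential sum over the members of `I` in a given cell. -/
noncomputable def cellSum (T : ℝ) (I : Finset ℕ) (r : ℚ) (i : ℕ) : ℂ :=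
  ∑ p ∈ I with cell T p = i, zeta r ^ p

/-- The weighted sum of the absolute values of the exponential sums over all cells. -/
noncomputable def cellNorm (T : ℝ) (I : Finset ℕ) (r : ℚ) : ℝ :=
  ∑ i ∈ I.image (cell T), exp (-((i + 1) / T)) * ‖cellSum T I r i‖

lemma card_filter_mul_le {x c : ℝ} (hx : 0 ≤ x) (hc : 0 < c) (s : Finset ℕ)
    (hs : ∀ m ∈ s, 1 ≤ m) :
    (#(s.filter fun m : ℕ => (m : ℝ) * c ≤ x) : ℝ) ≤ x / c := by
  have h : s.filter (fun m : ℕ => (m : ℝ) * c ≤ x) ⊆ Icc 1 ⌊x / c⌋₊ := by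
    intro m hm
    rw [Finset.mem_filter] at hm
    rw [Finset.mem_Icc, Nat.le_floor_iff (by positivity), le_div_iff₀ hc]
    exact ⟨hs m hm.1, hm.2⟩
  have h2 := Finset.card_le_card h
  rw [Nat.card_Icc, add_tsub_cancel_right] at h2
  exact (Nat.cast_le.2 h2).trans (Nat.floor_le (by positivity))

lemma norm_sum_triples_zeta_le {x T : ℝ} (hx : 0 ≤ x) (I : Finset ℕ) (f : ℕ → ℕ) (r : ℚ) :
    ‖∑ t ∈ triples x T I, zeta r ^ tripleVal f t‖ ≤ x * cellNorm T I r ^ 2 := by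
  set E : ℕ → ℝ := fun i => exp ((i + 1) / T)
  set M : ℕ → ℕ → ℂ := fun i j =>
    ∑ m ∈ (Icc 1 ⌊x⌋₊).filter (fun m : ℕ => (m : ℝ) * (E i * E j) ≤ x), zeta r ^ f m
  have hM : ∀ i j, ‖M i j‖ ≤ x * exp (-((i + 1) / T)) * exp (-((j + 1) / T)) := by
    intro i j
    refine (norm_sum_le _ _).trans ?_
    simp only [norm_pow, norm_zeta, one_pow, sum_const, nsmul_eq_mul, mul_one]
    refine (card_filter_mul_le hx (by positivity) _
      fun m hm => (Finset.mem_Icc.1 hm).1).trans (le_of_eq ?_)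
    simp only [E]
    rw [Real.exp_neg, Real.exp_neg, div_mul_eq_div_div]
    ring
  have h1 : ∑ t ∈ triples x T I, zeta r ^ tripleVal f t =
      ∑ p ∈ I, ∑ q ∈ I, zeta r ^ p * zeta r ^ q * M (cell T p) (cell T q) := by
    rw [triples, Finset.sum_filter, Finset.sum_product, Finset.sum_comm, Finset.sum_product]
    refine Finset.sum_congr rfl fun p _ => Finset.sum_congr rfl fun q _ => ?_
    simp only [M]
    rw [Finset.sum_filter, Finset.mul_sum]
    refine Finset.sum_congr rfl fun m _ => ?_
    simp only [E, mul_assoc, tripleVal]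
    split_ifs
    · rw [pow_add, pow_add]; ring
    · simp
  have h2 : ∑ p ∈ I, ∑ q ∈ I, zeta r ^ p * zeta r ^ q * M (cell T p) (cell T q) =
      ∑ i ∈ I.image (cell T), ∑ j ∈ I.image (cell T),
        cellSum T I r i * cellSum T I r j * M i j := by
    have hmaps : ∀ p ∈ I, cell T p ∈ I.image (cell T) := fun p hp =>
      Finset.mem_image_of_mem _ hp
    rw [← Finset.sum_fiberwise_of_maps_to hmaps]
    refine Finset.sum_congr rfl fun i _ => ?_
    simp_rw [cellSum, Finset.sum_mul_sum, Finset.sum_mul]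
    conv_rhs => rw [Finset.sum_comm]
    refine Finset.sum_congr rfl fun p hp => ?_
    rw [← Finset.sum_fiberwise_of_maps_to hmaps]
    refine Finset.sum_congr rfl fun j _ => Finset.sum_congr rfl fun q hq => ?_
    rw [(Finset.mem_filter.1 hp).2, (Finset.mem_filter.1 hq).2]
  rw [h1, h2, cellNorm, sq, Finset.sum_mul_sum, Finset.mul_sum]
  refine (norm_sum_le _ _).trans (Finset.sum_le_sum fun i _ => ?_)
  rw [Finset.mul_sum]
  refine (norm_sum_le _ _).trans (Finset.sum_le_sum fun j _ => ?_)
  rw [norm_mul, norm_mul]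
  calc _ ≤ ‖cellSum T I r i‖ * ‖cellSum T I r j‖ *
        (x * exp (-((i + 1) / T)) * exp (-((j + 1) / T))) :=
      mul_le_mul_of_nonneg_left (hM i j) (by positivity)
    _ = _ := by ring

lemma sum_sq_norm_cellSum_le {T : ℝ} (hT : 0 < T) {I : Finset ℕ} {D : ℕ} {R : Finset ℚ}
    (hD : 1 ≤ D) (hI : ∀ p ∈ I, D ^ 4 ≤ p)
    (hR : ∀ r ∈ R, 0 < r ∧ r < 1 ∧ r.den ≤ D) {i : ℕ} (hi : i ∈ I.image (cell T)) :
    exp (-((i + 1) / T)) ^ 2 * ∑ r ∈ R, ‖cellSum T I r i‖ ^ 2 ≤ 6 := by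
  obtain ⟨p₀, hp₀, rfl⟩ := Finset.mem_image.1 hi
  set i := cell T p₀
  set X : ℝ := exp ((i + 1) / T)
  have hX : 0 < X := Real.exp_pos _
  have hp₀pos : 0 < p₀ := (Nat.pow_pos hD).trans_le (hI p₀ hp₀)
  have hDX : (D : ℝ) ^ 4 ≤ X := by
    have h1 : ((D ^ 4 : ℕ) : ℝ) ≤ p₀ := by exact_mod_cast hI p₀ hp₀
    push_cast at h1
    exact h1.trans (lt_exp_cell hT hp₀pos).le
  have hX1 : 1 ≤ X := (one_le_pow₀ (by exact_mod_cast hD)).trans hDX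
  set N : ℕ := ⌊X⌋₊ + 1
  have hN : (N : ℝ) ≤ 2 * X := by
    have := Nat.floor_le hX.le
    simp only [N]; push_cast; linarith
  have hcs : ∀ r : ℚ, cellSum T I r i =
      ∑ n ∈ range N, (if n ∈ I ∧ cell T n = i then (1 : ℂ) else 0) * zeta r ^ n := by
    intro r
    simp only [ite_mul, one_mul, zero_mul]
    rw [← Finset.sum_filter, cellSum]
    refine Finset.sum_congr ?_ fun _ _ => rfl
    ext n
    simp only [Finset.mem_filter, Finset.mem_range]
    refine ⟨fun h => ⟨?_, h⟩, fun h => h.2⟩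
    have hn := lt_exp_cell hT ((Nat.pow_pos hD).trans_le (hI n h.1))
    rw [h.2] at hn
    exact Nat.lt_succ_of_le (Nat.le_floor hn.le)
  simp_rw [hcs]
  have h1 := large_sieve hR (fun n => if n ∈ I ∧ cell T n = i then (1 : ℂ) else 0) N
  have h2 : ∑ n ∈ range N, ‖(if n ∈ I ∧ cell T n = i then (1 : ℂ) else 0)‖ ^ 2 ≤ N := by
    calc _ ≤ ∑ n ∈ range N, (1 : ℝ) := Finset.sum_le_sum fun n _ => by split_ifs <;> simp
      _ = N := by simp
  have h3 : (#R : ℝ) ≤ D ^ 2 := by exact_mod_cast card_le_sq_of_den_le hR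
  have h4 : (N + (D : ℝ) ^ 2 * #R) ≤ 3 * X := by
    have : (D : ℝ) ^ 2 * #R ≤ D ^ 2 * D ^ 2 := mul_le_mul_of_nonneg_left h3 (by positivity)
    nlinarith
  have h5 := h1.trans (mul_le_mul h4 (h2.trans hN) (by positivity) (by positivity))
  rw [Real.exp_neg, inv_pow, inv_mul_le_iff₀ (by positivity)]
  refine h5.trans (le_of_eq ?_)
  simp only [X]
  ring

lemma sum_sq_cellNorm_le {T : ℝ} (hT : 0 < T) {I : Finset ℕ} {D : ℕ} {R : Finset ℚ}
    (hD : 1 ≤ D) (hI : ∀ p ∈ I, D ^ 4 ≤ p) (hR : ∀ r ∈ R, 0 < r ∧ r < 1 ∧ r.den ≤ D) :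
    ∑ r ∈ R, cellNorm T I r ^ 2 ≤ 6 * (#(I.image (cell T)) : ℝ) ^ 2 := by
  calc ∑ r ∈ R, cellNorm T I r ^ 2
      ≤ ∑ r ∈ R, #(I.image (cell T)) *
        ∑ i ∈ I.image (cell T), (exp (-((i + 1) / T)) * ‖cellSum T I r i‖) ^ 2 :=
        Finset.sum_le_sum fun r _ => sq_sum_le_card_mul_sum_sq
    _ = #(I.image (cell T)) * ∑ i ∈ I.image (cell T),
        exp (-((i + 1) / T)) ^ 2 * ∑ r ∈ R, ‖cellSum T I r i‖ ^ 2 := by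
        rw [← Finset.mul_sum, Finset.sum_comm]
        simp_rw [mul_pow, Finset.mul_sum]
    _ ≤ #(I.image (cell T)) * ∑ i ∈ I.image (cell T), 6 := by
        refine mul_le_mul_of_nonneg_left (Finset.sum_le_sum fun i hi => ?_) (by positivity)
        exact sum_sq_norm_cellSum_le hT hD hI hR hi
    _ = _ := by simp; ring

lemma card_image_cell_le {T Z : ℝ} (hT : 0 < T) {I : Finset ℕ}
    (hI : ∀ p ∈ I, 0 < p ∧ (p : ℝ) ≤ Z) (hZ : 1 ≤ Z) :
    (#(I.image (cell T)) : ℝ) ≤ T * log Z + 1 := by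
  have h : I.image (cell T) ⊆ range (⌊T * log Z⌋₊ + 1) := by
    intro i hi
    obtain ⟨p, hp, rfl⟩ := Finset.mem_image.1 hi
    rw [Finset.mem_range, Nat.lt_succ_iff]
    refine Nat.floor_mono (mul_le_mul_of_nonneg_left ?_ hT.le)
    exact Real.log_le_log (by exact_mod_cast (hI p hp).1) (hI p hp).2
  have h2 := Finset.card_le_card h
  rw [Finset.card_range] at h2
  have h3 : (#(I.image (cell T)) : ℝ) ≤ (⌊T * log Z⌋₊ : ℝ) + 1 := by exact_mod_cast h2
  have := Nat.floor_le (mul_nonneg hT.le (Real.log_nonneg hZ))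
  linarith

lemma sum_inv_multiples_le {D e : ℕ} {𝒟 : Finset ℕ} (he : 0 < e)
    (h𝒟 : ∀ d ∈ 𝒟, 0 < d ∧ d ≤ D) :
    ∑ d ∈ 𝒟 with e ∣ d, (d : ℝ)⁻¹ ≤ (e : ℝ)⁻¹ * (1 + log D) := by
  have h1 : ∑ d ∈ 𝒟 with e ∣ d, (d : ℝ)⁻¹ ≤ ∑ k ∈ Icc 1 D, ((e : ℝ)⁻¹ * (k : ℝ)⁻¹) := by
    have hinj : Set.InjOn (fun k : ℕ => e * k) (Icc 1 D : Finset ℕ) :=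
      fun a _ b _ hab => Nat.eq_of_mul_eq_mul_left he hab
    have h2 : ∑ k ∈ Icc 1 D, ((e : ℝ)⁻¹ * (k : ℝ)⁻¹) =
        ∑ d ∈ (Icc 1 D).image (fun k => e * k), (d : ℝ)⁻¹ := by
      rw [Finset.sum_image hinj]
      exact Finset.sum_congr rfl fun k _ => by push_cast; rw [mul_inv]
    rw [h2]
    refine Finset.sum_le_sum_of_subset_of_nonneg (fun d hd => ?_) fun _ _ _ => by positivity
    obtain ⟨hd, k, rfl⟩ := Finset.mem_filter.1 hd
    obtain ⟨h3, h4⟩ := h𝒟 _ hd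
    refine Finset.mem_image_of_mem _ (Finset.mem_Icc.2 ⟨?_, ?_⟩)
    · exact Nat.pos_of_mul_pos_left h3
    · exact (Nat.le_mul_of_pos_left k he).trans h4
  rw [← Finset.mul_sum] at h1
  refine h1.trans (mul_le_mul_of_nonneg_left ?_ (by positivity))
  have := harmonic_le_one_add_log D
  rw [harmonic_eq_sum_Icc] at this
  push_cast at this
  exact this

/-- On average over the moduli `d ∈ 𝒟`, the values `f m + p + q` are divisible by `d` with the
expected frequency. -/
theorem sum_abs_card_dvd_sub_le {x T D₀ : ℝ} (hx : 0 ≤ x) (hT : 0 < T) (hD₀ : 0 < D₀)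
    {I : Finset ℕ} {D : ℕ} (hD : 1 ≤ D) (hI : ∀ p ∈ I, D ^ 4 ≤ p) {𝒟 : Finset ℕ}
    (h𝒟 : ∀ d ∈ 𝒟, 0 < d ∧ d ≤ D) (h𝒟' : ∀ d ∈ 𝒟, ∀ e, e ∣ d → e ≠ 1 → D₀ ≤ e)
    (f : ℕ → ℕ) :
    ∑ d ∈ 𝒟, |(#((triples x T I).filter fun t => d ∣ tripleVal f t) : ℝ) -
      #(triples x T I) / d| ≤
      x * (6 * (#(I.image (cell T)) : ℝ) ^ 2) * ((1 + log D) / D₀) := by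
  set fracs : ℕ → Finset ℚ := fun d => (Ico 1 d).image fun a : ℕ => (a : ℚ) / d
  set R : Finset ℚ := 𝒟.biUnion fracs
  have hfr : ∀ d ∈ 𝒟, ∀ r ∈ fracs d, 0 < r ∧ r < 1 ∧ r.den ∣ d := by
    intro d hd r hr
    obtain ⟨a, ha, rfl⟩ := Finset.mem_image.1 hr
    rw [Finset.mem_Ico] at ha
    have hd0 : (0 : ℚ) < d := by exact_mod_cast (h𝒟 d hd).1
    refine ⟨div_pos (by exact_mod_cast ha.1) hd0, (div_lt_one hd0).2 (by exact_mod_cast ha.2), ?_⟩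
    have h3 := Rat.den_dvd a d
    rw [Rat.divInt_eq_div, Int.cast_natCast, Int.cast_natCast] at h3
    exact Int.natCast_dvd_natCast.1 h3
  have hR : ∀ r ∈ R, 0 < r ∧ r < 1 ∧ r.den ≤ D := by
    intro r hr
    obtain ⟨d, hd, hr⟩ := Finset.mem_biUnion.1 hr
    obtain ⟨h1, h2, h3⟩ := hfr d hd r hr
    exact ⟨h1, h2, (Nat.le_of_dvd (h𝒟 d hd).1 h3).trans (h𝒟 d hd).2⟩
  have hRD : ∀ r ∈ R, D₀ ≤ r.den := by
    intro r hr
    obtain ⟨d, hd, hr⟩ := Finset.mem_biUnion.1 hr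
    obtain ⟨h1, h2, h3⟩ := hfr d hd r hr
    refine h𝒟' d hd _ h3 fun h => ?_
    have h4 := Rat.mul_den_eq_num r
    rw [h] at h4
    have h5 : r = r.num := by simpa using h4
    rw [h5] at h1 h2
    have h6 : 0 < r.num := by exact_mod_cast h1
    have h7 : r.num < 1 := by exact_mod_cast h2
    omega
  have hsingle : ∀ d ∈ 𝒟, |(#((triples x T I).filter fun t => d ∣ tripleVal f t) : ℝ) -
      #(triples x T I) / d| ≤ ∑ r ∈ R, if r.den ∣ d then (d : ℝ)⁻¹ * (x * cellNorm T I r ^ 2)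
        else 0 := by
    intro d hd
    have hd0 := (h𝒟 d hd).1
    have hdC : (d : ℂ) ≠ 0 := by exact_mod_cast hd0.ne'
    have h1 : (d : ℂ) * ((#((triples x T I).filter fun t => d ∣ tripleVal f t) : ℂ) -
        #(triples x T I) / d) =
        ∑ r ∈ fracs d, ∑ t ∈ triples x T I, zeta r ^ tripleVal f t := by
      have h2 : (d : ℂ) * (#((triples x T I).filter fun t => d ∣ tripleVal f t) : ℂ) =
          ∑ a ∈ range d, ∑ t ∈ triples x T I, zeta ((a : ℚ) / d) ^ tripleVal f t := by
        rw [Finset.sum_comm]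
        simp_rw [sum_zeta_div_pow hd0]
        rw [← Finset.sum_filter, Finset.sum_const, nsmul_eq_mul, mul_comm]
      have hinj : Set.InjOn (fun a : ℕ => (a : ℚ) / d) (Ico 1 d : Finset ℕ) := by
        intro a _ b _ hab
        have hdQ : (d : ℚ) ≠ 0 := by exact_mod_cast hd0.ne'
        have : (a : ℚ) = b := (div_left_inj' hdQ).1 hab
        exact_mod_cast this
      rw [mul_sub, h2, mul_div_cancel₀ _ hdC, Finset.sum_image hinj, Finset.range_eq_Ico,
        Finset.sum_eq_sum_Ico_succ_bot hd0]
      simp [zeta]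
    have h3 : |(#((triples x T I).filter fun t => d ∣ tripleVal f t) : ℝ) -
        #(triples x T I) / d| = (d : ℝ)⁻¹ *
        ‖∑ r ∈ fracs d, ∑ t ∈ triples x T I, zeta r ^ tripleVal f t‖ := by
      rw [← h1, norm_mul, Complex.norm_natCast, inv_mul_cancel_left₀ (by exact_mod_cast hd0.ne'),
        ← Real.norm_eq_abs, ← Complex.norm_real]
      push_cast
      rfl
    rw [h3, ← Finset.sum_filter, ← Finset.mul_sum]
    refine mul_le_mul_of_nonneg_left ((norm_sum_le _ _).trans ?_) (by positivity)
    refine (Finset.sum_le_sum fun r _ => norm_sum_triples_zeta_le hx I f r).trans ?_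
    refine Finset.sum_le_sum_of_subset_of_nonneg (fun r hr => ?_) fun _ _ _ => by positivity
    exact Finset.mem_filter.2 ⟨Finset.mem_biUnion.2 ⟨d, hd, hr⟩, (hfr d hd r hr).2.2⟩
  refine (Finset.sum_le_sum hsingle).trans ?_
  rw [Finset.sum_comm]
  have hlogD : 0 ≤ log D := Real.log_natCast_nonneg D
  calc ∑ r ∈ R, ∑ d ∈ 𝒟, (if r.den ∣ d then (d : ℝ)⁻¹ * (x * cellNorm T I r ^ 2) else 0)
      ≤ ∑ r ∈ R, (x * cellNorm T I r ^ 2) * ((1 + log D) / D₀) := by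
        refine Finset.sum_le_sum fun r hr => ?_
        rw [← Finset.sum_filter, ← Finset.sum_mul, mul_comm]
        refine mul_le_mul_of_nonneg_left ?_ (by positivity)
        refine (sum_inv_multiples_le r.den_pos h𝒟).trans ?_
        rw [inv_mul_eq_div]
        exact div_le_div_of_nonneg_left (by positivity) hD₀ (hRD r hr)
    _ = x * (∑ r ∈ R, cellNorm T I r ^ 2) * ((1 + log D) / D₀) := by
        rw [← Finset.sum_mul, ← Finset.mul_sum]
    _ ≤ _ := by
        refine mul_le_mul_of_nonneg_right (mul_le_mul_of_nonneg_left ?_ hx) (by positivity)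
        exact sum_sq_cellNorm_le hT hD hI hR

end ErdosKac

namespace ErdosKac

open Finset Real

/-! ### Comparison of uniform integers with weighted triples -/

/-- The number of elements of `I` dividing `n`. -/
def omegaIn (I : Finset ℕ) (n : ℕ) : ℕ := #(I.filter (· ∣ n))

lemma card_multiples_le {x : ℝ} (hx : 0 ≤ x) (d : ℕ) :
    (#((Icc 1 ⌊x⌋₊).filter (d ∣ ·)) : ℝ) ≤ x / d := by
  have h : Icc 1 ⌊x⌋₊ = Ioc 0 ⌊x⌋₊ := rfl
  rw [h, Nat.Ioc_filter_dvd_card_eq_div, ← Nat.floor_div_natCast]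
  exact Nat.floor_le (by positivity)

lemma le_card_multiples (x : ℝ) (d : ℕ) :
    x / d - 1 ≤ (#((Icc 1 ⌊x⌋₊).filter (d ∣ ·)) : ℝ) := by
  have h : Icc 1 ⌊x⌋₊ = Ioc 0 ⌊x⌋₊ := rfl
  rw [h, Nat.Ioc_filter_dvd_card_eq_div, ← Nat.floor_div_natCast]
  have := Nat.lt_floor_add_one (x / d)
  linarith

lemma omegaIn_eq_sum (I : Finset ℕ) (n : ℕ) :
    (omegaIn I n : ℝ) = ∑ p ∈ I, if p ∣ n then 1 else 0 := by
  rw [omegaIn, Finset.card_filter]; push_cast; rfl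

section Turan

variable {x : ℝ} {I : Finset ℕ}

lemma sum_omegaIn (N : Finset ℕ) :
    ∑ n ∈ N, (omegaIn I n : ℝ) = ∑ p ∈ I, (#(N.filter (p ∣ ·)) : ℝ) := by
  simp_rw [omegaIn_eq_sum]
  rw [Finset.sum_comm]
  exact Finset.sum_congr rfl fun p _ => by rw [Finset.card_filter]; push_cast; rfl

lemma sum_omegaIn_le (hx : 0 ≤ x) :
    ∑ n ∈ Icc 1 ⌊x⌋₊, (omegaIn I n : ℝ) ≤ x * ∑ p ∈ I, (p : ℝ)⁻¹ := by
  rw [sum_omegaIn, Finset.mul_sum]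
  exact Finset.sum_le_sum fun p _ => by
    rw [← div_eq_mul_inv]; exact card_multiples_le hx p

lemma sum_omegaIn_sq_le (hx : 0 ≤ x) (hI : ∀ p ∈ I, p.Prime) :
    ∑ n ∈ Icc 1 ⌊x⌋₊, (omegaIn I n : ℝ) ^ 2 ≤
      x * (∑ p ∈ I, (p : ℝ)⁻¹) ^ 2 + x * ∑ p ∈ I, (p : ℝ)⁻¹ := by
  have h1 : ∑ n ∈ Icc 1 ⌊x⌋₊, (omegaIn I n : ℝ) ^ 2 =
      ∑ p ∈ I, ∑ q ∈ I, (#((Icc 1 ⌊x⌋₊).filter fun n => p ∣ n ∧ q ∣ n) : ℝ) := by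
    simp_rw [omegaIn_eq_sum, sq, Finset.sum_mul_sum]
    rw [Finset.sum_comm]
    refine Finset.sum_congr rfl fun p _ => ?_
    rw [Finset.sum_comm]
    refine Finset.sum_congr rfl fun q _ => ?_
    rw [Finset.card_filter]
    push_cast
    refine Finset.sum_congr rfl fun n _ => ?_
    by_cases h : p ∣ n <;> by_cases h' : q ∣ n <;> simp [h, h']
  have h2 : ∀ p ∈ I, ∀ q ∈ I, (#((Icc 1 ⌊x⌋₊).filter fun n => p ∣ n ∧ q ∣ n) : ℝ) ≤
      x * ((p : ℝ)⁻¹ * (q : ℝ)⁻¹) + if p = q then x * (p : ℝ)⁻¹ else 0 := by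
    intro p hp q hq
    split_ifs with h
    · subst h
      simp only [and_self]
      have := card_multiples_le hx p
      rw [div_eq_mul_inv] at this
      have : 0 ≤ x * ((p : ℝ)⁻¹ * (p : ℝ)⁻¹) := by positivity
      linarith
    · rw [add_zero]
      have hc : ((Icc 1 ⌊x⌋₊).filter fun n => p ∣ n ∧ q ∣ n) ⊆
          (Icc 1 ⌊x⌋₊).filter (p * q ∣ ·) := by
        intro n hn
        rw [Finset.mem_filter] at hn ⊢
        exact ⟨hn.1, ((Nat.coprime_primes (hI p hp) (hI q hq)).2 h).mul_dvd_of_dvd_of_dvd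
          hn.2.1 hn.2.2⟩
      refine (Nat.cast_le.2 (Finset.card_le_card hc)).trans
        ((card_multiples_le hx (p * q)).trans (le_of_eq ?_))
      push_cast
      rw [div_eq_mul_inv, mul_inv]
  rw [h1]
  refine (Finset.sum_le_sum fun p hp => Finset.sum_le_sum fun q hq => h2 p hp q hq).trans
    (le_of_eq ?_)
  simp_rw [Finset.sum_add_distrib]
  congr 1
  · rw [sq, Finset.sum_mul_sum, Finset.mul_sum]
    exact Finset.sum_congr rfl fun p _ => by rw [Finset.mul_sum]
  · rw [Finset.mul_sum]
    exact Finset.sum_congr rfl fun p hp => by rw [Finset.sum_ite_eq, if_pos hp]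

/-- Turán's variance bound. -/
lemma sum_omegaIn_sub_sq_le (hx : 0 ≤ x) (hI : ∀ p ∈ I, p.Prime ∧ (p : ℝ) ≤ x) :
    ∑ n ∈ Icc 1 ⌊x⌋₊, ((omegaIn I n : ℝ) - ∑ p ∈ I, (p : ℝ)⁻¹) ^ 2 ≤
      3 * x * ∑ p ∈ I, (p : ℝ)⁻¹ := by
  set E := ∑ p ∈ I, (p : ℝ)⁻¹
  have hE : 0 ≤ E := by positivity
  have h1 := sum_omegaIn_sq_le hx (fun p hp => (hI p hp).1)
  have h2 : x * E - x ≤ ∑ n ∈ Icc 1 ⌊x⌋₊, (omegaIn I n : ℝ) := by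
    rw [sum_omegaIn]
    have h3 : ∑ p ∈ I, (x / p - 1) ≤ ∑ p ∈ I, (#((Icc 1 ⌊x⌋₊).filter (p ∣ ·)) : ℝ) :=
      Finset.sum_le_sum fun p _ => le_card_multiples x p
    have h4 : (#I : ℝ) ≤ x := by
      have : I ⊆ Icc 1 ⌊x⌋₊ := fun p hp =>
        Finset.mem_Icc.2 ⟨(hI p hp).1.one_le, Nat.le_floor (hI p hp).2⟩
      have h5 := Finset.card_le_card this
      rw [Nat.card_Icc, add_tsub_cancel_right] at h5
      exact (Nat.cast_le.2 h5).trans (Nat.floor_le hx)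
    have h6 : ∑ p ∈ I, (x / p - 1) = x * E - #I := by
      rw [Finset.sum_sub_distrib, Finset.mul_sum]
      simp [div_eq_mul_inv]
    linarith
  have h3 : ∑ n ∈ Icc 1 ⌊x⌋₊, ((omegaIn I n : ℝ) - E) ^ 2 =
      ∑ n ∈ Icc 1 ⌊x⌋₊, (omegaIn I n : ℝ) ^ 2 - 2 * E * ∑ n ∈ Icc 1 ⌊x⌋₊, (omegaIn I n : ℝ) +
        E ^ 2 * ⌊x⌋₊ := by
    simp_rw [sub_sq]
    rw [Finset.sum_add_distrib, Finset.sum_sub_distrib, Finset.mul_sum]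
    congr 1
    · congr 1
      exact Finset.sum_congr rfl fun n _ => by ring
    · simp [mul_comm]
  have h4 := Nat.floor_le hx
  have h5 := mul_le_mul_of_nonneg_left h2 (by positivity : 0 ≤ 2 * E)
  have h6 := mul_le_mul_of_nonneg_left h4 (by positivity : 0 ≤ E ^ 2)
  rw [h3]
  nlinarith

end Turan

section Triples

variable {x T : ℝ} {I : Finset ℕ}

/-- The product attached to a triple. -/
def tripleProd (t : ℕ × ℕ × ℕ) : ℕ := t.1 * t.2.1 * t.2.2

/-- The number of representations of `n` as the product of a triple. -/
noncomputable def reps (x T : ℝ) (I : Finset ℕ) (n : ℕ) : ℕ :=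
  #((triples x T I).filter fun t => tripleProd t = n)

lemma mem_triples {t : ℕ × ℕ × ℕ} : t ∈ triples x T I ↔
    (1 ≤ t.1 ∧ t.1 ≤ ⌊x⌋₊) ∧ (t.2.1 ∈ I ∧ t.2.2 ∈ I) ∧
    t.1 * exp ((cell T t.2.1 + 1) / T) * exp ((cell T t.2.2 + 1) / T) ≤ x := by
  simp only [triples, Finset.mem_filter, Finset.mem_product, Finset.mem_Icc, and_assoc]

lemma tripleProd_mem (hT : 0 < T) (hI : ∀ p ∈ I, 0 < p) {t : ℕ × ℕ × ℕ}
    (ht : t ∈ triples x T I) : tripleProd t ∈ Icc 1 ⌊x⌋₊ := by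
  obtain ⟨⟨h1, -⟩, ⟨hp, hq⟩, h4⟩ := mem_triples.1 ht
  have hp0 := hI _ hp
  have hq0 := hI _ hq
  rw [Finset.mem_Icc]
  refine ⟨Nat.mul_pos (Nat.mul_pos h1 hp0) hq0, Nat.le_floor (le_trans ?_ h4)⟩
  rw [tripleProd]
  push_cast
  have := (lt_exp_cell hT hp0).le
  have := (lt_exp_cell hT hq0).le
  gcongr

lemma reps_le (n : ℕ) (hn : 0 < n) : reps x T I n ≤ omegaIn I n ^ 2 := by
  rw [sq, omegaIn, ← Finset.card_product]
  refine Finset.card_le_card_of_injOn (fun t => t.2) (fun t ht => ?_) ?_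
  · obtain ⟨ht1, rfl⟩ := Finset.mem_filter.1 ht
    obtain ⟨-, ⟨hp, hq⟩, -⟩ := mem_triples.1 ht1
    refine Finset.mem_product.2 ⟨Finset.mem_filter.2 ⟨hp, ?_⟩, Finset.mem_filter.2 ⟨hq, ?_⟩⟩
    · exact (Dvd.intro_left _ rfl).mul_right _
    · exact Dvd.intro_left _ rfl
  · intro t ht s hs hts
    have ht' := (Finset.mem_filter.1 ht).2
    have hs' := (Finset.mem_filter.1 hs).2
    have hts' : t.2 = s.2 := hts
    refine Prod.ext ?_ hts'
    rw [tripleProd, mul_assoc] at ht' hs'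
    rw [← hts', ← ht'] at hs'
    have hpos : 0 < t.2.1 * t.2.2 := by
      rcases Nat.eq_zero_or_pos (t.2.1 * t.2.2) with h | h
      · rw [h] at ht'; omega
      · exact h
    exact (Nat.eq_of_mul_eq_mul_right hpos hs').symm

lemma le_reps (hT : 0 < T) (hI : ∀ p ∈ I, p.Prime) {n : ℕ} (hn : 0 < n)
    (hnx : n * exp (2 / T) ≤ x) : omegaIn I n ^ 2 ≤ reps x T I n + omegaIn I n := by
  have hmain : #((I.filter (· ∣ n)).offDiag) ≤ reps x T I n := by
    have hdvd : ∀ pq ∈ (I.filter (· ∣ n)).offDiag, pq.1 * pq.2 ∣ n := by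
      intro pq hpq
      obtain ⟨h1, h2, h3⟩ := Finset.mem_offDiag.1 hpq
      rw [Finset.mem_filter] at h1 h2
      exact ((Nat.coprime_primes (hI _ h1.1) (hI _ h2.1)).2 h3).mul_dvd_of_dvd_of_dvd h1.2 h2.2
    refine Finset.card_le_card_of_injOn (fun pq => (n / (pq.1 * pq.2), pq.1, pq.2))
      (fun pq hpq => ?_) ?_
    · have hd := hdvd pq hpq
      obtain ⟨h1, h2, h3⟩ := Finset.mem_offDiag.1 hpq
      rw [Finset.mem_filter] at h1 h2
      have hp0 := (hI _ h1.1).pos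
      have hq0 := (hI _ h2.1).pos
      have hprod : n / (pq.1 * pq.2) * pq.1 * pq.2 = n := by
        rw [mul_assoc]; exact Nat.div_mul_cancel hd
      refine Finset.mem_filter.2 ⟨mem_triples.2 ⟨⟨?_, ?_⟩, ⟨h1.1, h2.1⟩, ?_⟩, hprod⟩
      · exact Nat.div_pos (Nat.le_of_dvd hn hd) (Nat.mul_pos hp0 hq0)
      · refine (Nat.div_le_self _ _).trans (Nat.le_floor (le_trans ?_ hnx))
        exact le_mul_of_one_le_right (by positivity) (Real.one_le_exp (by positivity))
      · refine le_trans ?_ hnx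
        have e1 : exp ((cell T pq.1 + 1) / T) ≤ pq.1 * exp (1 / T) := by
          rw [add_div, Real.exp_add]
          exact mul_le_mul_of_nonneg_right (exp_cell_le hT hp0) (Real.exp_pos _).le
        have e2 : exp ((cell T pq.2 + 1) / T) ≤ pq.2 * exp (1 / T) := by
          rw [add_div, Real.exp_add]
          exact mul_le_mul_of_nonneg_right (exp_cell_le hT hq0) (Real.exp_pos _).le
        have e3 : exp (2 / T) = exp (1 / T) * exp (1 / T) := by
          rw [← Real.exp_add]; congr 1; ring
        calc ((n / (pq.1 * pq.2) : ℕ) : ℝ) * exp ((cell T pq.1 + 1) / T) *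
              exp ((cell T pq.2 + 1) / T)
            ≤ ((n / (pq.1 * pq.2) : ℕ) : ℝ) * (pq.1 * exp (1 / T)) * (pq.2 * exp (1 / T)) := by
              gcongr
          _ = ((n / (pq.1 * pq.2) * pq.1 * pq.2 : ℕ) : ℝ) * exp (2 / T) := by
              push_cast; rw [e3]; ring
          _ = n * exp (2 / T) := by rw [hprod]
    · intro a _ b _ hab
      simp only [Prod.mk.injEq] at hab
      exact Prod.ext hab.2.1 hab.2.2
  rw [Finset.offDiag_card] at hmain
  rw [sq]
  have h : #(I.filter (· ∣ n)) = omegaIn I n := rfl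
  rw [h] at hmain
  omega

lemma card_near_le (hx : 0 ≤ x) (hT : 0 < T) :
    (#((Icc 1 ⌊x⌋₊).filter fun n : ℕ => ¬ (n * exp (2 / T) ≤ x)) : ℝ) ≤ 2 * x / T + 1 := by
  set c := x * exp (-(2 / T))
  have hc : 0 ≤ c := by positivity
  have hsub : (Icc 1 ⌊x⌋₊).filter (fun n : ℕ => ¬ (n * exp (2 / T) ≤ x)) ⊆ Ioc ⌊c⌋₊ ⌊x⌋₊ := by
    intro n hn
    rw [Finset.mem_filter, Finset.mem_Icc, not_le] at hn
    rw [Finset.mem_Ioc, Nat.floor_lt hc]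
    refine ⟨?_, hn.1.2⟩
    simp only [c]
    rw [Real.exp_neg, ← div_eq_mul_inv, div_lt_iff₀ (Real.exp_pos _)]
    exact hn.2
  have h1 := Finset.card_le_card hsub
  rw [Nat.card_Ioc] at h1
  have hcx : c ≤ x := mul_le_of_le_one_right hx (Real.exp_le_one_iff.2 (by
    have : 0 < 2 / T := by positivity
    linarith))
  have h2 : ((⌊x⌋₊ - ⌊c⌋₊ : ℕ) : ℝ) = ⌊x⌋₊ - ⌊c⌋₊ := Nat.cast_sub (Nat.floor_mono hcx)
  have h3 := Nat.floor_le hx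
  have h4 := Nat.lt_floor_add_one c
  have h5 : x - c ≤ 2 * x / T := by
    have := Real.add_one_le_exp (-(2 / T))
    have h6 := mul_le_mul_of_nonneg_left this hx
    have : x * (2 / T) = 2 * x / T := by ring
    simp only [c]
    linarith
  have h7 : (#((Icc 1 ⌊x⌋₊).filter fun n : ℕ => ¬ (n * exp (2 / T) ≤ x)) : ℝ) ≤
      ((⌊x⌋₊ - ⌊c⌋₊ : ℕ) : ℝ) := by exact_mod_cast h1
  linarith

/-- The number of representations is close to its mean for most integers. -/
lemma sum_abs_reps_sub_le (hx : 0 < x) (hT : 0 < T) (hI : ∀ p ∈ I, p.Prime ∧ (p : ℝ) ≤ x)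
    (hE : 1 ≤ ∑ p ∈ I, (p : ℝ)⁻¹) :
    ∑ n ∈ Icc 1 ⌊x⌋₊, |(reps x T I n : ℝ) - (∑ p ∈ I, (p : ℝ)⁻¹) ^ 2| ≤
      x * (∑ p ∈ I, (p : ℝ)⁻¹) ^ 2 * (8 / √(∑ p ∈ I, (p : ℝ)⁻¹) + 2 / T + 1 / x) := by
  have hvar := sum_omegaIn_sub_sq_le hx.le hI
  have hmean := sum_omegaIn_le (I := I) hx.le
  have hnear := card_near_le hx.le hT
  set E := ∑ p ∈ I, (p : ℝ)⁻¹
  set s := √E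
  have hs2 : s ^ 2 = E := Real.sq_sqrt (by linarith)
  have hs1 : 1 ≤ s := Real.one_le_sqrt.2 hE
  have hpt : ∀ n ∈ Icc 1 ⌊x⌋₊, |(reps x T I n : ℝ) - E ^ 2| ≤
      (1 + s) * ((omegaIn I n : ℝ) - E) ^ 2 + s * E + omegaIn I n +
        if ¬ (n * exp (2 / T) ≤ x) then E ^ 2 else 0 := by
    intro n hn
    have hn0 : 0 < n := (Finset.mem_Icc.1 hn).1
    have hu : (reps x T I n : ℝ) ≤ (omegaIn I n : ℝ) ^ 2 := by exact_mod_cast reps_le n hn0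
    have hl : n * exp (2 / T) ≤ x → (omegaIn I n : ℝ) ^ 2 ≤ reps x T I n + omegaIn I n :=
      fun h => by exact_mod_cast le_reps hT (fun p hp => (hI p hp).1) hn0 h
    set w : ℝ := (omegaIn I n : ℝ)
    have hw : 0 ≤ w := Nat.cast_nonneg _
    have hsq : |w ^ 2 - E ^ 2| ≤ (1 + s) * (w - E) ^ 2 + s * E := by
      have h1 : 2 * E * |w - E| ≤ s * (w - E) ^ 2 + s * E := by
        have h2 : 0 ≤ s * (|w - E| - s) ^ 2 := by positivity
        have h3 : s * (|w - E| - s) ^ 2 = s * (w - E) ^ 2 - 2 * s ^ 2 * |w - E| + s * s ^ 2 := by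
          rw [sub_sq, sq_abs]; ring
        rw [h3, hs2] at h2
        linarith
      have h4 : w ^ 2 - E ^ 2 = (w - E) ^ 2 + 2 * E * (w - E) := by ring
      rw [h4]
      refine (abs_add_le _ _).trans ?_
      rw [abs_of_nonneg (sq_nonneg (w - E)), abs_mul, abs_of_nonneg (by linarith : 0 ≤ 2 * E)]
      linarith
    have hrn : (0 : ℝ) ≤ reps x T I n := Nat.cast_nonneg _
    split_ifs with h
    · have hl := hl h
      rw [abs_le] at hsq ⊢
      constructor <;> linarith
    · rw [abs_le] at hsq ⊢
      have : 0 ≤ (1 + s) * (w - E) ^ 2 + s * E := by positivity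
      constructor <;> nlinarith
  refine (Finset.sum_le_sum hpt).trans ?_
  rw [Finset.sum_add_distrib, Finset.sum_add_distrib, Finset.sum_add_distrib, ← Finset.mul_sum,
    ← Finset.sum_filter, Finset.sum_const, Finset.sum_const, nsmul_eq_mul, nsmul_eq_mul,
    Nat.card_Icc, add_tsub_cancel_right]
  have hfl := Nat.floor_le hx.le
  have h1 := mul_le_mul_of_nonneg_left hvar (by linarith : 0 ≤ 1 + s)
  have h2 := mul_le_mul_of_nonneg_right hfl (by positivity : 0 ≤ s * E)
  have h3 := mul_le_mul_of_nonneg_right hnear (by positivity : 0 ≤ E ^ 2)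
  have e1 : x * E ^ 2 * (8 / s + 2 / T + 1 / x) =
      8 * x * E * s + (2 * x / T + 1) * E ^ 2 := by
    have : E ^ 2 / s = E * s := by
      rw [div_eq_iff (by linarith)]
      calc E ^ 2 = E * E := sq E
        _ = E * s ^ 2 := by rw [hs2]
        _ = E * s * s := by ring
    calc x * E ^ 2 * (8 / s + 2 / T + 1 / x)
        = 8 * x * (E ^ 2 / s) + (2 * x / T + x / x) * E ^ 2 := by ring
      _ = _ := by rw [this, div_self hx.ne']; ring
  rw [e1]
  have h5 : x * E ≤ x * E * s := le_mul_of_one_le_right (by positivity) hs1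
  nlinarith

lemma card_exceptional_le (hx : 0 ≤ x) {k : ℕ} (hI : ∀ p ∈ I, k < p) :
    (#((Icc 1 ⌊x⌋₊).filter fun n => ∃ p ∈ I, p ^ 2 ∣ n) : ℝ) ≤ x * (2 / (k + 1)) := by
  have h1 : (Icc 1 ⌊x⌋₊).filter (fun n => ∃ p ∈ I, p ^ 2 ∣ n) ⊆
      I.biUnion fun p => (Icc 1 ⌊x⌋₊).filter (p ^ 2 ∣ ·) := by
    intro n hn
    obtain ⟨h1, p, hp, h2⟩ := Finset.mem_filter.1 hn
    exact Finset.mem_biUnion.2 ⟨p, hp, Finset.mem_filter.2 ⟨h1, h2⟩⟩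
  have h2 := (Finset.card_le_card h1).trans Finset.card_biUnion_le
  have h3 : (#((Icc 1 ⌊x⌋₊).filter fun n => ∃ p ∈ I, p ^ 2 ∣ n) : ℝ) ≤
      ∑ p ∈ I, x * ((p : ℝ) ^ 2)⁻¹ := by
    refine (Nat.cast_le.2 h2).trans ?_
    push_cast
    refine Finset.sum_le_sum fun p _ => ?_
    have := card_multiples_le hx (p ^ 2)
    push_cast at this
    rwa [div_eq_mul_inv] at this
  refine h3.trans ?_
  rw [← Finset.mul_sum]
  refine mul_le_mul_of_nonneg_left ?_ hx
  refine le_trans ?_ (sum_Ioo_inv_sq_le (α := ℝ) k (I.sup id + 1))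
  refine Finset.sum_le_sum_of_subset_of_nonneg (fun p hp => ?_) fun _ _ _ => by positivity
  rw [Finset.mem_Ioo]
  exact ⟨hI p hp, Nat.lt_succ_of_le (Finset.le_sup (f := id) hp)⟩

/-- The error in comparing averages over integers with averages over triples. -/
noncomputable def comparisonError (x T E : ℝ) (k : ℕ) : ℝ :=
  32 / √E + 8 / T + 5 / x + 4 / (k + 1)

variable {f : ℕ → ℕ} {k : ℕ}

/-- Averages of `g ∘ f` over integers agree with averages of `g (f m + p + q)` over triples. -/
theorem norm_average_sub_average_le (hx : 1 ≤ x) (hT : 0 < T)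
    (hI : ∀ p ∈ I, p.Prime ∧ k < p ∧ (p : ℝ) ≤ x) (hE : 1 ≤ ∑ p ∈ I, (p : ℝ)⁻¹)
    (hf : ∀ m p q : ℕ, 0 < m → p.Prime → q.Prime → p ≠ q → ¬ p ∣ m → ¬ q ∣ m →
      f (m * p * q) = f m + p + q)
    (herr : comparisonError x T (∑ p ∈ I, (p : ℝ)⁻¹) k ≤ 1 / 2) :
    x / 2 ≤ #(triples x T I) ∧ ∀ g : ℕ → ℂ, (∀ n, ‖g n‖ ≤ 1) →
      ‖(∑ n ∈ Icc 1 ⌊x⌋₊, g (f n)) / x -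
        (∑ t ∈ triples x T I, g (tripleVal f t)) / #(triples x T I)‖ ≤
      comparisonError x T (∑ p ∈ I, (p : ℝ)⁻¹) k := by
  have hx0 : 0 < x := by linarith
  have hreps := sum_abs_reps_sub_le hx0 hT (fun p hp => ⟨(hI p hp).1, (hI p hp).2.2⟩) hE
  have hexc := card_exceptional_le hx0.le (I := I) (k := k) (fun p hp => (hI p hp).2.1)
  set E := ∑ p ∈ I, (p : ℝ)⁻¹
  set τ := 8 / √E + 2 / T + 1 / x
  have herr_eq : comparisonError x T E k = 4 * τ + 1 / x + 4 / (k + 1) := by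
    rw [comparisonError]; simp only [τ]; ring
  set 𝒯 := triples x T I
  have hmem : ∀ t ∈ 𝒯, tripleProd t ∈ Icc 1 ⌊x⌋₊ := fun t ht =>
    tripleProd_mem hT (fun p hp => (hI p hp).1.pos) ht
  have hE0 : 0 < E := by linarith
  have hE2 : 1 ≤ E ^ 2 := one_le_pow₀ hE
  have hτ : 0 ≤ τ := by positivity
  -- sums over triples of functions of the product
  have hfib : ∀ h : ℕ → ℂ, ∑ t ∈ 𝒯, h (tripleProd t) =
      ∑ n ∈ Icc 1 ⌊x⌋₊, (reps x T I n : ℂ) * h n := by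
    intro h
    rw [← Finset.sum_fiberwise_of_maps_to hmem]
    refine Finset.sum_congr rfl fun n _ => ?_
    rw [Finset.sum_congr rfl (g := fun _ => h n)
      (fun t ht => by rw [(Finset.mem_filter.1 ht).2]), Finset.sum_const, nsmul_eq_mul]
    rfl
  have hcomp : ∀ h : ℕ → ℂ, (∀ n, ‖h n‖ ≤ 1) →
      ‖(E : ℂ) ^ 2 * ∑ n ∈ Icc 1 ⌊x⌋₊, h n - ∑ t ∈ 𝒯, h (tripleProd t)‖ ≤ x * E ^ 2 * τ := by
    intro h hh
    rw [hfib, Finset.mul_sum, ← Finset.sum_sub_distrib]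
    refine (norm_sum_le _ _).trans (le_trans (Finset.sum_le_sum fun n _ => ?_) hreps)
    rw [← sub_mul, norm_mul, abs_sub_comm]
    refine (mul_le_of_le_one_right (norm_nonneg _) (hh n)).trans (le_of_eq ?_)
    rw [← Real.norm_eq_abs, ← Complex.norm_real]
    push_cast
    rfl
  have hcard : |(#𝒯 : ℝ) / (x * E ^ 2) - 1| ≤ τ + 1 / x := by
    have h1 := hcomp (fun _ => 1) (by simp)
    simp only [sum_const, Nat.card_Icc, add_tsub_cancel_right, nsmul_eq_mul, mul_one] at h1
    have h2 : |E ^ 2 * ⌊x⌋₊ - #𝒯| ≤ x * E ^ 2 * τ := by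
      rw [← Real.norm_eq_abs, ← Complex.norm_real]
      push_cast
      exact h1
    have hfl := Nat.floor_le hx0.le
    have hfl' := Nat.lt_floor_add_one x
    have h3 : |(#𝒯 : ℝ) - x * E ^ 2| ≤ (τ + 1 / x) * (x * E ^ 2) := by
      have e : (τ + 1 / x) * (x * E ^ 2) = x * E ^ 2 * τ + E ^ 2 := by
        field_simp
      rw [e]
      rw [abs_le] at h2 ⊢
      constructor <;> nlinarith
    have h4 : (#𝒯 : ℝ) / (x * E ^ 2) - 1 = ((#𝒯 : ℝ) - x * E ^ 2) / (x * E ^ 2) := by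
      field_simp
    rw [h4, abs_div, abs_of_pos (by positivity : 0 < x * E ^ 2), div_le_iff₀ (by positivity)]
    exact h3
  have hk : (0 : ℝ) ≤ 4 / (k + 1) := by positivity
  have hx' : 0 ≤ 1 / x := by positivity
  have hcard_lb : x / 2 ≤ #𝒯 := by
    have h1 := (abs_le.1 hcard).1
    have h2 : 1 / 2 ≤ (#𝒯 : ℝ) / (x * E ^ 2) := by linarith
    rw [le_div_iff₀ (by positivity)] at h2
    nlinarith
  refine ⟨hcard_lb, fun g hg => ?_⟩
  have h𝒯0 : (0 : ℝ) < #𝒯 := by linarith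
  -- bad triples
  set bad := 𝒯.filter fun t => ∃ p ∈ I, p ^ 2 ∣ tripleProd t
  have hbad : (#bad : ℝ) ≤ x * E ^ 2 * τ + E ^ 2 * (x * (2 / (k + 1))) := by
    have h1 : (#bad : ℝ) = ∑ n ∈ (Icc 1 ⌊x⌋₊).filter (fun n => ∃ p ∈ I, p ^ 2 ∣ n),
        (reps x T I n : ℝ) := by
      have h2 : ∀ t ∈ bad, tripleProd t ∈
          (Icc 1 ⌊x⌋₊).filter (fun n => ∃ p ∈ I, p ^ 2 ∣ n) := fun t ht =>
        Finset.mem_filter.2 ⟨hmem t (Finset.mem_filter.1 ht).1, (Finset.mem_filter.1 ht).2⟩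
      rw [Finset.card_eq_sum_card_fiberwise h2]
      push_cast
      refine Finset.sum_congr rfl fun n hn => ?_
      rw [reps]
      congr 2
      ext t
      simp only [bad, Finset.mem_filter]
      constructor
      · rintro ⟨⟨h3, -⟩, h4⟩; exact ⟨h3, h4⟩
      · rintro ⟨h3, h4⟩; exact ⟨⟨h3, h4 ▸ (Finset.mem_filter.1 hn).2⟩, h4⟩
    rw [h1]
    calc _ ≤ ∑ n ∈ (Icc 1 ⌊x⌋₊).filter (fun n => ∃ p ∈ I, p ^ 2 ∣ n),
          (|(reps x T I n : ℝ) - E ^ 2| + E ^ 2) :=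
          Finset.sum_le_sum fun n _ => by linarith [le_abs_self ((reps x T I n : ℝ) - E ^ 2)]
      _ ≤ _ := by
          rw [Finset.sum_add_distrib, Finset.sum_const, nsmul_eq_mul, mul_comm _ (E ^ 2)]
          refine add_le_add (le_trans ?_ hreps) (mul_le_mul_of_nonneg_left hexc (by positivity))
          exact Finset.sum_le_sum_of_subset_of_nonneg (Finset.filter_subset _ _)
            fun _ _ _ => abs_nonneg _
  have hgood : ∀ t ∈ 𝒯, t ∉ bad → f (tripleProd t) = tripleVal f t := by
    intro t ht hb
    obtain ⟨⟨h1, -⟩, ⟨hp, hq⟩, -⟩ := mem_triples.1 ht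
    have hno : ∀ p ∈ I, ¬ p ^ 2 ∣ tripleProd t := fun p hp h =>
      hb (Finset.mem_filter.2 ⟨ht, p, hp, h⟩)
    refine hf _ _ _ h1 (hI _ hp).1 (hI _ hq).1 (fun h => ?_) (fun h => ?_) (fun h => ?_)
    · refine hno _ hp ⟨t.1, ?_⟩
      rw [tripleProd, ← h]; ring
    · obtain ⟨c, hc⟩ := h
      refine hno _ hp ⟨c * t.2.2, ?_⟩
      rw [tripleProd, hc]; ring
    · obtain ⟨c, hc⟩ := h
      refine hno _ hq ⟨c * t.2.1, ?_⟩
      rw [tripleProd, hc]; ring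
  have hdiff : ‖∑ t ∈ 𝒯, g (f (tripleProd t)) - ∑ t ∈ 𝒯, g (tripleVal f t)‖ ≤ 2 * #bad := by
    rw [← Finset.sum_sub_distrib,
      ← Finset.sum_subset (Finset.filter_subset (fun t => ∃ p ∈ I, p ^ 2 ∣ tripleProd t) 𝒯)
        (fun t ht hb => by rw [hgood t ht hb, sub_self])]
    refine (norm_sum_le _ _).trans ?_
    refine (Finset.sum_le_sum (g := fun _ => (2 : ℝ)) fun t _ => ?_).trans (le_of_eq ?_)
    · refine (norm_sub_le _ _).trans ?_
      linarith [hg (f (tripleProd t)), hg (tripleVal f t)]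
    · rw [Finset.sum_const, nsmul_eq_mul, mul_comm]
  have hA := hcomp (fun n => g (f n)) (fun n => hg _)
  set S₁ := ∑ n ∈ Icc 1 ⌊x⌋₊, g (f n)
  set S₂ := ∑ t ∈ 𝒯, g (f (tripleProd t))
  set S₃ := ∑ t ∈ 𝒯, g (tripleVal f t)
  have hS₃ : ‖S₃‖ ≤ #𝒯 := by
    refine (norm_sum_le _ _).trans ((Finset.sum_le_sum fun t _ => hg _).trans (by simp))
  have hc : (0 : ℝ) < x * E ^ 2 := by positivity
  have hmain : ‖(E : ℂ) ^ 2 * S₁ - S₃‖ ≤ (3 * τ + 4 / (k + 1)) * (x * E ^ 2) := by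
    have e : (E : ℂ) ^ 2 * S₁ - S₃ = ((E : ℂ) ^ 2 * S₁ - S₂) + (S₂ - S₃) := by ring
    rw [e]
    refine (norm_add_le _ _).trans ?_
    have e2 : (3 * τ + 4 / ((k : ℝ) + 1)) * (x * E ^ 2) =
        x * E ^ 2 * τ + 2 * (x * E ^ 2 * τ + E ^ 2 * (x * (2 / (k + 1)))) := by ring
    rw [e2]
    linarith
  have hxC : (x : ℂ) ≠ 0 := by exact_mod_cast hx0.ne'
  have hEC : (E : ℂ) ≠ 0 := by exact_mod_cast hE0.ne'
  have h𝒯C : (#𝒯 : ℂ) ≠ 0 := by exact_mod_cast h𝒯0.ne'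
  have hsplit : S₁ / x - S₃ / #𝒯 = ((E : ℂ) ^ 2 * S₁ - S₃) / (x * E ^ 2 : ℝ) +
      (S₃ / #𝒯) * (((#𝒯 : ℝ) / (x * E ^ 2) - 1 : ℝ) : ℂ) := by
    push_cast
    field_simp
    ring
  rw [hsplit, herr_eq]
  refine (norm_add_le _ _).trans ?_
  have hb1 : ‖((E : ℂ) ^ 2 * S₁ - S₃) / (x * E ^ 2 : ℝ)‖ ≤ 3 * τ + 4 / (k + 1) := by
    rw [norm_div, Complex.norm_real, Real.norm_of_nonneg hc.le, div_le_iff₀ hc]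
    exact hmain
  have hb2 : ‖(S₃ / #𝒯) * (((#𝒯 : ℝ) / (x * E ^ 2) - 1 : ℝ) : ℂ)‖ ≤ τ + 1 / x := by
    rw [norm_mul, Complex.norm_real, Real.norm_eq_abs]
    refine (mul_le_of_le_one_left (abs_nonneg _) ?_).trans hcard
    rw [norm_div, Complex.norm_natCast, div_le_one h𝒯0]
    exact hS₃
  linarith

end Triples

end ErdosKac

namespace ErdosKac

section Moments

open Finset Real
open scoped BigOperators Nat

/-- The sum of the errors of `s`-averages of divisibility by products of at most `k`
elements of `Q`. -/
noncomputable def sieveError {α : Type*} (Q : Finset ℕ) (k : ℕ) (s : Finset α) (b : α → ℕ) : ℝ :=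
  ∑ A ∈ Q.powerset with #A ≤ k,
    |(𝔼 t ∈ s, if (∏ q ∈ A, q) ∣ b t then (1 : ℝ) else 0) - ((∏ q ∈ A, q : ℕ) : ℝ)⁻¹|

lemma sieveError_nonneg {α : Type*} (Q : Finset ℕ) (k : ℕ) (s : Finset α) (b : α → ℕ) :
    0 ≤ sieveError Q k s b := Finset.sum_nonneg fun _ _ => abs_nonneg _

variable {Q : Finset ℕ}

lemma prod_dvd_iff (hQ : ∀ q ∈ Q, q.Prime) {n : ℕ} : (∏ q ∈ Q, q) ∣ n ↔ ∀ q ∈ Q, q ∣ n :=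
  ⟨fun h _ hq => (Finset.dvd_prod_of_mem _ hq).trans h,
    fun h => Finset.prod_primes_dvd n (fun q hq => (hQ q hq).prime) h⟩

lemma prod_pos_of_prime (hQ : ∀ q ∈ Q, q.Prime) : 0 < ∏ q ∈ Q, q :=
  Finset.prod_pos fun q hq => (hQ q hq).pos

lemma omegaIn_pow (hQ : ∀ q ∈ Q, q.Prime) (n i : ℕ) :
    (omegaIn Q n : ℝ) ^ i = ∑ f ∈ Fintype.piFinset (fun _ : Fin i => Q),
      if (∏ q ∈ univ.image f, q) ∣ n then 1 else 0 := by
  rw [omegaIn_eq_sum, Finset.sum_pow']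
  refine Finset.sum_congr rfl fun f hf => ?_
  rw [Fintype.mem_piFinset] at hf
  have hp : ∀ q ∈ univ.image f, q.Prime := by
    intro q hq
    obtain ⟨j, -, rfl⟩ := Finset.mem_image.1 hq
    exact hQ _ (hf j)
  by_cases h : ∀ j, f j ∣ n
  · rw [if_pos ((prod_dvd_iff hp).2 (by simpa using h))]
    exact Finset.prod_eq_one fun j _ => if_pos (h j)
  · rw [if_neg (mt (prod_dvd_iff hp).1 (by simpa using h))]
    obtain ⟨j, hj⟩ := not_forall.1 h
    exact Finset.prod_eq_zero (Finset.mem_univ j) (if_neg hj)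

variable {α : Type*} {s : Finset α} {b : α → ℕ}

lemma abs_expect_omegaIn_pow_sub_le {β : Type*} {r : Finset β} {c : β → ℕ}
    (hQ : ∀ q ∈ Q, q.Prime) {i k : ℕ} (hik : i ≤ k) :
    |(𝔼 t ∈ s, (omegaIn Q (b t) : ℝ) ^ i) - 𝔼 t ∈ r, (omegaIn Q (c t) : ℝ) ^ i| ≤
      (k : ℝ) ^ i * (sieveError Q k s b + sieveError Q k r c) := by
  classical
  set F : Finset ℕ → ℝ := fun A => (𝔼 t ∈ s, if (∏ q ∈ A, q) ∣ b t then (1 : ℝ) else 0) -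
    𝔼 t ∈ r, if (∏ q ∈ A, q) ∣ c t then (1 : ℝ) else 0
  have h1 : (𝔼 t ∈ s, (omegaIn Q (b t) : ℝ) ^ i) - (𝔼 t ∈ r, (omegaIn Q (c t) : ℝ) ^ i) =
      ∑ f ∈ Fintype.piFinset (fun _ : Fin i => Q), F (univ.image f) := by
    simp only [omegaIn_pow hQ, Finset.expect_sum_comm, F, Finset.sum_sub_distrib]
  rw [h1]
  refine (Finset.abs_sum_le_sum_abs _ _).trans ?_
  have hmaps : ∀ f ∈ Fintype.piFinset (fun _ : Fin i => Q),
      univ.image f ∈ Q.powerset.filter (#· ≤ k) := by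
    intro f hf
    rw [Fintype.mem_piFinset] at hf
    rw [Finset.mem_filter, Finset.mem_powerset]
    refine ⟨fun q hq => ?_, (Finset.card_image_le.trans (by simp)).trans hik⟩
    obtain ⟨j, -, rfl⟩ := Finset.mem_image.1 hq
    exact hf j
  rw [← Finset.sum_fiberwise_of_maps_to hmaps, sieveError, sieveError, ← Finset.sum_add_distrib,
    Finset.mul_sum]
  refine Finset.sum_le_sum fun A hA => ?_
  have h2 : ∑ f ∈ Fintype.piFinset (fun _ : Fin i => Q) with univ.image f = A,
      |F (univ.image f)| =
        ((#{f ∈ Fintype.piFinset (fun _ : Fin i => Q) | univ.image f = A} : ℕ) : ℝ)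
        * |F A| := by
    rw [← nsmul_eq_mul, ← Finset.sum_const]
    exact Finset.sum_congr rfl fun f hf => by rw [(Finset.mem_filter.1 hf).2]
  rw [h2]
  have h3 : #{f ∈ Fintype.piFinset (fun _ : Fin i => Q) | univ.image f = A} ≤ k ^ i := by
    calc #{f ∈ Fintype.piFinset (fun _ : Fin i => Q) | univ.image f = A}
        ≤ #(Fintype.piFinset (fun _ : Fin i => A)) := by
          refine Finset.card_le_card fun f hf => ?_
          rw [Fintype.mem_piFinset]
          intro j
          rw [← (Finset.mem_filter.1 hf).2]
          exact Finset.mem_image_of_mem _ (Finset.mem_univ _)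
      _ = #A ^ i := Fintype.card_piFinset_const _ _
      _ ≤ k ^ i := Nat.pow_le_pow_left (Finset.mem_filter.1 hA).2 _
  have h4 : ((#{f ∈ Fintype.piFinset (fun _ : Fin i => Q) | univ.image f = A} : ℕ) : ℝ) ≤
      (k : ℝ) ^ i := by exact_mod_cast h3
  have h5 := abs_sub_le (𝔼 t ∈ s, if (∏ q ∈ A, q) ∣ b t then (1 : ℝ) else 0)
    ((∏ q ∈ A, q : ℕ) : ℝ)⁻¹ (𝔼 t ∈ r, if (∏ q ∈ A, q) ∣ c t then (1 : ℝ) else 0)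
  rw [abs_sub_comm ((∏ q ∈ A, q : ℕ) : ℝ)⁻¹] at h5
  exact mul_le_mul h4 h5 (abs_nonneg _) (by positivity)

lemma abs_expect_central_moment_sub_le {β : Type*} {r : Finset β} {c : β → ℕ}
    (hQ : ∀ q ∈ Q, q.Prime) {j k : ℕ} (hjk : j ≤ k) (hk : 1 ≤ k) {μ : ℝ} (hμ : 0 ≤ μ) :
    |(𝔼 t ∈ s, ((omegaIn Q (b t) : ℝ) - μ) ^ j) - 𝔼 t ∈ r, ((omegaIn Q (c t) : ℝ) - μ) ^ j| ≤
      (k * (1 + μ)) ^ j * (sieveError Q k s b + sieveError Q k r c) := by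
  set η := sieveError Q k s b + sieveError Q k r c
  have hη : 0 ≤ η := add_nonneg (sieveError_nonneg _ _ _ _) (sieveError_nonneg _ _ _ _)
  have h1 : (𝔼 t ∈ s, ((omegaIn Q (b t) : ℝ) - μ) ^ j) -
      (𝔼 t ∈ r, ((omegaIn Q (c t) : ℝ) - μ) ^ j) =
      ∑ i ∈ range (j + 1), ((𝔼 t ∈ s, (omegaIn Q (b t) : ℝ) ^ i) -
        𝔼 t ∈ r, (omegaIn Q (c t) : ℝ) ^ i) * ((-μ) ^ (j - i) * j.choose i) := by
    simp only [sub_eq_add_neg _ μ, add_pow, Finset.expect_sum_comm, mul_assoc,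
      ← Finset.expect_mul, sub_mul, Finset.sum_sub_distrib]
  rw [h1]
  refine (Finset.abs_sum_le_sum_abs _ _).trans ?_
  have hk1 : (1 : ℝ) ≤ k := by exact_mod_cast hk
  have h2 : (k * (1 + μ)) ^ j * η = ∑ i ∈ range (j + 1),
      ((k : ℝ) ^ j * η) * (μ ^ (j - i) * j.choose i) := by
    rw [← Finset.mul_sum, mul_pow, add_pow]
    simp only [one_pow, one_mul]
    ring
  rw [h2]
  refine Finset.sum_le_sum fun i hi => ?_
  have hij : i ≤ j := Nat.lt_succ_iff.1 (Finset.mem_range.1 hi)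
  rw [abs_mul, abs_mul, abs_pow, abs_neg, abs_of_nonneg hμ, Nat.abs_cast]
  refine mul_le_mul_of_nonneg_right ?_ (by positivity)
  refine (abs_expect_omegaIn_pow_sub_le hQ (hij.trans hjk)).trans ?_
  exact mul_le_mul_of_nonneg_right (pow_le_pow_right₀ hk1 hij) hη

end Moments

section Taylor

open Finset
open scoped Nat

lemma norm_exp_sub_sum_le_of_nonneg {c : ℂ} (hc : ‖c‖ = 1) (hre : c.re = 0) (k : ℕ) :
    ∀ {y : ℝ}, 0 ≤ y →
      ‖Complex.exp (c * y) - ∑ j ∈ range k, (c * y) ^ j / (j ! : ℂ)‖ ≤ y ^ k / k ! := by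
  induction k with
  | zero =>
    intro y _
    simp [Complex.norm_exp, hre]
  | succ k ih =>
    intro y hy
    set f : ℝ → ℂ := fun y => Complex.exp (c * y) - ∑ j ∈ range (k + 1), (c * y) ^ j / (j ! : ℂ)
    have hlin (x : ℝ) : HasDerivAt (fun y : ℝ => c * (y : ℂ)) c x := by
      simpa using (Complex.ofRealCLM.hasDerivAt (x := x)).const_mul c
    have hderiv (x : ℝ) : HasDerivAt f
        (c * (Complex.exp (c * x) - ∑ j ∈ range k, (c * x) ^ j / (j ! : ℂ))) x := by
      have h1 : HasDerivAt (fun y : ℝ => ∑ j ∈ range (k + 1), (c * y) ^ j / (j ! : ℂ))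
          (∑ j ∈ range (k + 1), ((j : ℂ) * (c * x) ^ (j - 1) * c) / (j ! : ℂ)) x :=
        HasDerivAt.fun_sum fun j _ => ((hlin x).pow j).div_const _
      have h2 := ((hlin x).cexp).sub h1
      convert! h2 using 1
      rw [Finset.sum_range_succ', mul_sub, mul_comm c (Complex.exp _), Finset.mul_sum]
      simp only [Nat.cast_zero, zero_mul, zero_div, add_zero]
      congr 1
      refine Finset.sum_congr rfl fun j _ => ?_
      have : ((j : ℂ) + 1) ≠ 0 := by exact_mod_cast Nat.succ_ne_zero j
      have : (j ! : ℂ) ≠ 0 := by exact_mod_cast Nat.factorial_ne_zero j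
      rw [Nat.factorial_succ]
      push_cast
      field_simp
    have hB (x : ℝ) : HasDerivAt (fun y : ℝ => y ^ (k + 1) / ((k + 1) ! : ℝ))
        (x ^ k / (k ! : ℝ)) x := by
      have h := (hasDerivAt_pow (k + 1) x).div_const ((k + 1) ! : ℝ)
      convert! h using 1
      have : ((k : ℝ) + 1) ≠ 0 := by positivity
      have : (k ! : ℝ) ≠ 0 := by positivity
      rw [Nat.factorial_succ]
      push_cast
      field_simp
    refine image_norm_le_of_norm_deriv_right_le_deriv_boundary (a := 0) (b := y) (f := f)
      (f' := fun x => c * (Complex.exp (c * x) - ∑ j ∈ range k, (c * x) ^ j / (j ! : ℂ)))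
      (B := fun y => y ^ (k + 1) / ((k + 1) ! : ℝ)) (B' := fun x => x ^ k / (k ! : ℝ))
      (fun x _ => (hderiv x).continuousAt.continuousWithinAt)
      (fun x _ => (hderiv x).hasDerivWithinAt) ?_ hB ?_ ⟨hy, le_rfl⟩
    · simp only [f]
      rw [Finset.sum_range_succ']
      simp
    · intro x hx
      rw [norm_mul, hc, one_mul]
      exact ih hx.1

/-- Taylor's inequality for the exponential on the imaginary axis. -/
lemma norm_exp_mul_I_sub_sum_le (y : ℝ) (k : ℕ) :
    ‖Complex.exp (y * Complex.I) - ∑ j ∈ range k, (y * Complex.I) ^ j / (j ! : ℂ)‖ ≤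
      |y| ^ k / k ! := by
  rcases le_total 0 y with hy | hy
  · have := norm_exp_sub_sum_le_of_nonneg (c := Complex.I) (by simp) (by simp) k hy
    rwa [abs_of_nonneg hy, mul_comm (y : ℂ)]
  · have := norm_exp_sub_sum_le_of_nonneg (c := -Complex.I) (by simp) (by simp) k
      (neg_nonneg.2 hy)
    rw [abs_of_nonpos hy]
    have e : -Complex.I * ((-y : ℝ) : ℂ) = y * Complex.I := by push_cast; ring
    rwa [e] at this

end Taylor

end ErdosKac

namespace ErdosKac

section Model

open Finset Real
open scoped BigOperators Nat

variable {Q : Finset ℕ}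

lemma expect_dvd {K : Type*} [Field K] [CharZero K] {M d : ℕ} (hM : 0 < M) (hd : d ∣ M) :
    (𝔼 n ∈ Ioc 0 M, if d ∣ n then (1 : K) else 0) = (d : K)⁻¹ := by
  have hM' : (M : K) ≠ 0 := by exact_mod_cast hM.ne'
  have hd0 : d ≠ 0 := by rintro rfl; exact hM.ne' (zero_dvd_iff.1 hd)
  have hd' : (d : K) ≠ 0 := by exact_mod_cast hd0
  rw [Finset.expect_eq_sum_div_card, Finset.sum_boole, Nat.Ioc_filter_dvd_card_eq_div,
    Nat.cast_div hd hd', Nat.card_Ioc, Nat.sub_zero]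
  field_simp

lemma sieveError_model (hQ : ∀ q ∈ Q, q.Prime) (k : ℕ) :
    sieveError Q k (Ioc 0 (∏ q ∈ Q, q)) id = 0 := by
  refine Finset.sum_eq_zero fun A hA => ?_
  have hA := Finset.mem_powerset.1 (Finset.mem_filter.1 hA).1
  simp only [id]
  rw [expect_dvd (prod_pos_of_prime hQ) (Finset.prod_dvd_prod_of_subset _ _ _ hA), sub_self,
    abs_zero]

lemma expect_pow_omegaIn {K : Type*} [Field K] [CharZero K] (hQ : ∀ q ∈ Q, q.Prime) (z : K) :
    𝔼 n ∈ Ioc 0 (∏ q ∈ Q, q), z ^ omegaIn Q n = ∏ q ∈ Q, (1 + (z - 1) * (q : K)⁻¹) := by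
  have h1 (n : ℕ) : z ^ omegaIn Q n =
      ∑ A ∈ Q.powerset, (z - 1) ^ #A * if (∏ q ∈ A, q) ∣ n then (1 : K) else 0 := by
    have h2 : z ^ omegaIn Q n = ∏ q ∈ Q, (1 + if q ∣ n then z - 1 else 0) := by
      rw [omegaIn, ← Finset.prod_const, Finset.prod_filter]
      exact Finset.prod_congr rfl fun q _ => by split_ifs <;> simp
    rw [h2, Finset.prod_one_add]
    refine Finset.sum_congr rfl fun A hA => ?_
    have hAp : ∀ q ∈ A, q.Prime := fun q hq => hQ q (Finset.mem_powerset.1 hA hq)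
    by_cases h : ∀ q ∈ A, q ∣ n
    · rw [if_pos ((prod_dvd_iff hAp).2 h), mul_one, ← Finset.prod_const]
      exact Finset.prod_congr rfl fun q hq => if_pos (h q hq)
    · rw [if_neg (mt (prod_dvd_iff hAp).1 h), mul_zero]
      push Not at h
      obtain ⟨q, hq, hqn⟩ := h
      exact Finset.prod_eq_zero hq (if_neg hqn)
  simp only [h1, Finset.expect_sum_comm, ← Finset.mul_expect]
  rw [Finset.prod_one_add]
  refine Finset.sum_congr rfl fun A hA => ?_
  rw [expect_dvd (prod_pos_of_prime hQ)
    (Finset.prod_dvd_prod_of_subset _ _ _ (Finset.mem_powerset.1 hA)), Finset.prod_mul_distrib,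
    Finset.prod_const, Finset.prod_inv_distrib]
  push_cast
  rfl

lemma expect_exp_le (hQ : ∀ q ∈ Q, q.Prime) {θ : ℝ} (hθ : |θ| ≤ 1) :
    𝔼 n ∈ Ioc 0 (∏ q ∈ Q, q), exp (θ * ((omegaIn Q n : ℝ) - ∑ q ∈ Q, (q : ℝ)⁻¹)) ≤
      exp ((∑ q ∈ Q, (q : ℝ)⁻¹) * θ ^ 2) := by
  set μ := ∑ q ∈ Q, (q : ℝ)⁻¹
  have hμ : 0 ≤ μ := Finset.sum_nonneg fun _ _ => by positivity
  have h1 (n : ℕ) : exp (θ * ((omegaIn Q n : ℝ) - μ)) = exp θ ^ omegaIn Q n * exp (-(θ * μ)) := by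
    rw [← Real.exp_nat_mul, ← Real.exp_add]; congr 1; ring
  simp only [h1, ← Finset.expect_mul]
  rw [expect_pow_omegaIn hQ]
  have h2 : ∏ q ∈ Q, (1 + (exp θ - 1) * (q : ℝ)⁻¹) ≤ exp (μ * (exp θ - 1)) := by
    rw [Finset.sum_mul, Real.exp_sum]
    refine Finset.prod_le_prod (fun q hq => ?_) fun q hq => ?_
    · have h3 : (q : ℝ)⁻¹ ≤ 1 := Nat.cast_inv_le_one q
      have h4 : 0 ≤ (q : ℝ)⁻¹ := by positivity
      nlinarith [Real.exp_pos θ]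
    · rw [add_comm, mul_comm]; exact Real.add_one_le_exp _
  refine (mul_le_mul_of_nonneg_right h2 (Real.exp_pos _).le).trans ?_
  rw [← Real.exp_add, Real.exp_le_exp]
  have h5 := (abs_le.1 (Real.abs_exp_sub_one_sub_id_le hθ)).2
  nlinarith

lemma expect_central_moment_le (hQ : ∀ q ∈ Q, q.Prime) {θ : ℝ} (hθ : 0 ≤ θ) (hθ1 : θ ≤ 1)
    {k : ℕ} (hk : Even k) :
    θ ^ k / k ! * 𝔼 n ∈ Ioc 0 (∏ q ∈ Q, q), ((omegaIn Q n : ℝ) - ∑ q ∈ Q, (q : ℝ)⁻¹) ^ k ≤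
      2 * exp ((∑ q ∈ Q, (q : ℝ)⁻¹) * θ ^ 2) := by
  have h1 := expect_exp_le hQ (θ := θ) (by rwa [abs_of_nonneg hθ])
  have h2 := expect_exp_le hQ (θ := -θ) (by rwa [abs_neg, abs_of_nonneg hθ])
  rw [neg_sq] at h2
  rw [two_mul]
  refine le_trans ?_ (add_le_add h1 h2)
  rw [Finset.mul_expect, ← Finset.expect_add_distrib]
  refine Finset.expect_le_expect fun n _ => ?_
  set y := (omegaIn Q n : ℝ) - ∑ q ∈ Q, (q : ℝ)⁻¹
  have h3 := Real.pow_div_factorial_le_exp _ (abs_nonneg (θ * y)) k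
  rw [hk.pow_abs, mul_pow] at h3
  have h4 : exp |θ * y| ≤ exp (θ * y) + exp (-θ * y) := by
    rw [neg_mul]
    rcases abs_choice (θ * y) with h | h <;> rw [h] <;>
      linarith [Real.exp_pos (θ * y), Real.exp_pos (-(θ * y))]
  calc θ ^ k / k ! * y ^ k = θ ^ k * y ^ k / k ! := by ring
    _ ≤ _ := h3.trans h4

lemma norm_expect_exp_sub_sum_le {γ : Type*} (u : Finset γ) (c : γ → ℕ) (θ μ : ℝ) {k : ℕ}
    (hk : Even k) :
    ‖(𝔼 t ∈ u, Complex.exp ((θ * ((omegaIn Q (c t) : ℝ) - μ) : ℝ) * Complex.I)) -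
      ∑ j ∈ range k, ((𝔼 t ∈ u, ((omegaIn Q (c t) : ℝ) - μ) ^ j : ℝ) : ℂ) *
        ((θ * Complex.I) ^ j / (j ! : ℂ))‖ ≤
      |θ| ^ k / k ! * 𝔼 t ∈ u, ((omegaIn Q (c t) : ℝ) - μ) ^ k := by
  have h1 : ∑ j ∈ range k, ((𝔼 t ∈ u, ((omegaIn Q (c t) : ℝ) - μ) ^ j : ℝ) : ℂ) *
        ((θ * Complex.I) ^ j / (j ! : ℂ)) =
      𝔼 t ∈ u, ∑ j ∈ range k, ((θ * ((omegaIn Q (c t) : ℝ) - μ) : ℝ) * Complex.I) ^ j /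
        (j ! : ℂ) := by
    rw [Finset.expect_sum_comm]
    refine Finset.sum_congr rfl fun j _ => ?_
    rw [Complex.ofReal_expect, Finset.expect_mul]
    refine Finset.expect_congr rfl fun t _ => ?_
    push_cast
    rw [mul_assoc, mul_comm (_ - _) Complex.I, ← mul_assoc, mul_pow _ ((_ : ℂ) - _)]
    ring
  rw [h1, ← Finset.expect_sub_distrib]
  refine (RCLike.norm_expect_le (K := ℂ)).trans ?_
  rw [Finset.mul_expect]
  refine Finset.expect_le_expect fun t _ => ?_
  refine (norm_exp_mul_I_sub_sum_le _ k).trans (le_of_eq ?_)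
  rw [abs_mul, mul_pow, hk.pow_abs ((omegaIn Q (c t) : ℝ) - μ)]
  ring

variable {α : Type*} {s : Finset α} {b : α → ℕ}

/-- Comparison of the characteristic function of a truncated number of prime factors with that
of its model, by moments. -/
lemma norm_expect_exp_sub_model_le (hQ : ∀ q ∈ Q, q.Prime) {θ Λ : ℝ} (hΛ1 : Λ ≤ 1)
    (hθ : |θ| ≤ Λ / 2) {k : ℕ} (hk : Even k) (hk1 : 1 ≤ k) :
    ‖(𝔼 t ∈ s, Complex.exp ((θ * ((omegaIn Q (b t) : ℝ) - ∑ q ∈ Q, (q : ℝ)⁻¹) : ℝ) * Complex.I)) -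
      𝔼 n ∈ Ioc 0 (∏ q ∈ Q, q),
        Complex.exp ((θ * ((omegaIn Q n : ℝ) - ∑ q ∈ Q, (q : ℝ)⁻¹) : ℝ) * Complex.I)‖ ≤
      sieveError Q k s b * exp (|θ| * (k * (1 + ∑ q ∈ Q, (q : ℝ)⁻¹))) +
        4 * (1 / 2) ^ k * exp ((∑ q ∈ Q, (q : ℝ)⁻¹) * Λ ^ 2) := by
  have hΛ : 0 ≤ Λ := by linarith [abs_nonneg θ]
  have hmom := expect_central_moment_le hQ hΛ hΛ1 hk
  set μ := ∑ q ∈ Q, (q : ℝ)⁻¹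
  have hμ : 0 ≤ μ := Finset.sum_nonneg fun _ _ => by positivity
  set r := Ioc 0 (∏ q ∈ Q, q)
  set η := sieveError Q k s b
  have hη : 0 ≤ η := sieveError_nonneg _ _ _ _
  have hcomp (j : ℕ) (hj : j ≤ k) : |(𝔼 t ∈ s, ((omegaIn Q (b t) : ℝ) - μ) ^ j) -
      𝔼 n ∈ r, ((omegaIn Q n : ℝ) - μ) ^ j| ≤ (k * (1 + μ)) ^ j * η := by
    have := abs_expect_central_moment_sub_le (s := s) (b := b) (r := r) (c := id) hQ hj hk1 hμ
    rwa [sieveError_model hQ, add_zero] at this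
  have hs := norm_expect_exp_sub_sum_le (Q := Q) s b θ μ hk
  have hr := norm_expect_exp_sub_sum_le (Q := Q) r id θ μ hk
  simp only [id] at hr
  set Fs := 𝔼 t ∈ s, Complex.exp ((θ * ((omegaIn Q (b t) : ℝ) - μ) : ℝ) * Complex.I)
  set Fr := 𝔼 n ∈ r, Complex.exp ((θ * ((omegaIn Q n : ℝ) - μ) : ℝ) * Complex.I)
  set Ps := ∑ j ∈ range k, ((𝔼 t ∈ s, ((omegaIn Q (b t) : ℝ) - μ) ^ j : ℝ) : ℂ) *
          ((θ * Complex.I) ^ j / (j ! : ℂ))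
  set Pr := ∑ j ∈ range k, ((𝔼 n ∈ r, ((omegaIn Q n : ℝ) - μ) ^ j : ℝ) : ℂ) *
          ((θ * Complex.I) ^ j / (j ! : ℂ))
  have hP : ‖Ps - Pr‖ ≤ ∑ j ∈ range k, η * ((|θ| * (k * (1 + μ))) ^ j / j !) := by
    simp only [Ps, Pr]
    rw [← Finset.sum_sub_distrib]
    refine (norm_sum_le _ _).trans (Finset.sum_le_sum fun j hj => ?_)
    rw [← sub_mul, norm_mul, ← Complex.ofReal_sub, Complex.norm_real, Real.norm_eq_abs, norm_div,
      norm_pow, norm_mul, Complex.norm_I, mul_one, Complex.norm_real, Real.norm_eq_abs,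
      Complex.norm_natCast]
    calc _ ≤ (k * (1 + μ)) ^ j * η * (|θ| ^ j / j !) :=
          mul_le_mul_of_nonneg_right (hcomp j (Finset.mem_range.1 hj).le) (by positivity)
      _ = _ := by rw [mul_pow |θ|]; ring
  have hlast : |θ| ^ k / k ! * 𝔼 t ∈ s, ((omegaIn Q (b t) : ℝ) - μ) ^ k ≤
      |θ| ^ k / k ! * (𝔼 n ∈ r, ((omegaIn Q n : ℝ) - μ) ^ k) +
        η * ((|θ| * (k * (1 + μ))) ^ k / k !) := by
    have h1 := (abs_le.1 (hcomp k le_rfl)).2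
    have h2 := mul_le_mul_of_nonneg_left h1 (by positivity : 0 ≤ |θ| ^ k / k !)
    have h3 : |θ| ^ k / k ! * ((k * (1 + μ)) ^ k * η) =
      η * ((|θ| * (k * (1 + μ))) ^ k / k !) := by
        rw [mul_pow |θ|]; ring
    rw [h3, mul_sub] at h2
    linarith
  have hmodel : |θ| ^ k / k ! * (𝔼 n ∈ r, ((omegaIn Q n : ℝ) - μ) ^ k) ≤
      2 * (1 / 2) ^ k * exp (μ * Λ ^ 2) := by
    have h0 : 0 ≤ 𝔼 n ∈ r, ((omegaIn Q n : ℝ) - μ) ^ k :=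
      Finset.expect_nonneg fun n _ => hk.pow_nonneg _
    have h1 : |θ| ^ k ≤ (Λ / 2) ^ k := pow_le_pow_left₀ (abs_nonneg _) hθ k
    calc _ ≤ (Λ / 2) ^ k / k ! * (𝔼 n ∈ r, ((omegaIn Q n : ℝ) - μ) ^ k) := by gcongr
      _ = (1 / 2) ^ k * (Λ ^ k / k ! * (𝔼 n ∈ r, ((omegaIn Q n : ℝ) - μ) ^ k)) := by
        rw [div_pow, div_pow, one_pow]; ring
      _ ≤ (1 / 2) ^ k * (2 * exp (μ * Λ ^ 2)) := by gcongr
      _ = _ := by ring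
  have hexp : ∑ j ∈ range k, η * ((|θ| * (k * (1 + μ))) ^ j / j !) +
      η * ((|θ| * (k * (1 + μ))) ^ k / k !) ≤ η * exp (|θ| * (k * (1 + μ))) := by
    rw [← Finset.sum_range_succ, ← Finset.mul_sum]
    exact mul_le_mul_of_nonneg_left (Real.sum_le_exp_of_nonneg (by positivity) _) hη
  calc ‖Fs - Fr‖ = ‖(Fs - Ps) + (Ps - Pr) - (Fr - Pr)‖ := by congr 1; ring
    _ ≤ ‖Fs - Ps‖ + ‖Ps - Pr‖ + ‖Fr - Pr‖ :=
      (norm_sub_le _ _).trans (add_le_add (norm_add_le _ _) le_rfl)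
    _ ≤ _ := by linarith

lemma norm_prod_sub_prod_le_sum {ι : Type*} (u : Finset ι) (a c : ι → ℂ)
    (ha : ∀ i ∈ u, ‖a i‖ ≤ 1) (hc : ∀ i ∈ u, ‖c i‖ ≤ 1) :
    ‖∏ i ∈ u, a i - ∏ i ∈ u, c i‖ ≤ ∑ i ∈ u, ‖a i - c i‖ := by
  classical
  induction u using Finset.induction_on with
  | empty => simp
  | insert i u hi ih =>
    rw [Finset.prod_insert hi, Finset.prod_insert hi, Finset.sum_insert hi]
    have h1 := ih (fun j hj => ha j (Finset.mem_insert_of_mem hj))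
      fun j hj => hc j (Finset.mem_insert_of_mem hj)
    have h2 : ‖∏ j ∈ u, a j‖ ≤ 1 := by
      rw [norm_prod]
      exact Finset.prod_le_one (fun _ _ => norm_nonneg _)
        fun j hj => ha j (Finset.mem_insert_of_mem hj)
    have h3 := hc i (Finset.mem_insert_self _ _)
    calc ‖a i * ∏ j ∈ u, a j - c i * ∏ j ∈ u, c j‖
        = ‖(a i - c i) * ∏ j ∈ u, a j + c i * (∏ j ∈ u, a j - ∏ j ∈ u, c j)‖ := by
          congr 1; ring
      _ ≤ ‖a i - c i‖ * ‖∏ j ∈ u, a j‖ + ‖c i‖ * ‖∏ j ∈ u, a j - ∏ j ∈ u, c j‖ := by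
          rw [← norm_mul, ← norm_mul]; exact norm_add_le _ _
      _ ≤ ‖a i - c i‖ * 1 + 1 * ‖∏ j ∈ u, a j - ∏ j ∈ u, c j‖ := by gcongr
      _ ≤ _ := by linarith

/-- The characteristic function of the model is almost Gaussian. -/
lemma norm_expect_model_sub_le (hQ : ∀ q ∈ Q, q.Prime) {θ ε : ℝ} (hθ : |θ| ≤ 1)
    (hε : ∀ q ∈ Q, (q : ℝ)⁻¹ ≤ ε) :
    ‖(𝔼 n ∈ Ioc 0 (∏ q ∈ Q, q),
        Complex.exp ((θ * ((omegaIn Q n : ℝ) - ∑ q ∈ Q, (q : ℝ)⁻¹) : ℝ) * Complex.I)) -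
      Complex.exp (-(θ ^ 2 * (∑ q ∈ Q, (q : ℝ)⁻¹) / 2 : ℝ))‖ ≤
      (∑ q ∈ Q, (q : ℝ)⁻¹) * (|θ| ^ 3 + 4 * θ ^ 2 * ε) := by
  have h1 (n : ℕ) : Complex.exp ((θ * ((omegaIn Q n : ℝ) - ∑ q ∈ Q, (q : ℝ)⁻¹) : ℝ) * Complex.I) =
      Complex.exp (θ * Complex.I) ^ omegaIn Q n *
        ∏ q ∈ Q, Complex.exp (-(θ * Complex.I) * (q : ℂ)⁻¹) := by
    rw [← Complex.exp_nat_mul, ← Complex.exp_sum, ← Complex.exp_add, ← Finset.mul_sum]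
    congr 1
    push_cast
    ring
  have h2 : Complex.exp (-(θ ^ 2 * (∑ q ∈ Q, (q : ℝ)⁻¹) / 2 : ℝ)) =
      ∏ q ∈ Q, Complex.exp (-(θ ^ 2 / 2) * (q : ℂ)⁻¹) := by
    rw [← Complex.exp_sum, ← Finset.mul_sum]
    congr 1
    push_cast
    ring
  simp only [h1, ← Finset.expect_mul]
  rw [expect_pow_omegaIn hQ, h2, ← Finset.prod_mul_distrib, Finset.sum_mul]
  have hθ2 : θ ^ 2 ≤ |θ| := by rw [← sq_abs]; nlinarith [abs_nonneg θ]
  have hn1 (q : ℕ) : ‖Complex.exp (-(θ * Complex.I) * (q : ℂ)⁻¹)‖ = 1 := by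
    rw [Complex.norm_exp]; simp
  refine (norm_prod_sub_prod_le_sum _ _ _ (fun q hq => ?_) fun q hq => ?_).trans
    (Finset.sum_le_sum fun q hq => ?_)
  · rw [norm_mul, hn1, mul_one]
    have h3 : (q : ℝ)⁻¹ ≤ 1 := Nat.cast_inv_le_one q
    have h4 : 1 + (Complex.exp (θ * Complex.I) - 1) * (q : ℂ)⁻¹ =
        ((1 - (q : ℝ)⁻¹ : ℝ) : ℂ) + Complex.exp (θ * Complex.I) * ((q : ℝ)⁻¹ : ℝ) := by
      push_cast; ring
    rw [h4]
    refine (norm_add_le _ _).trans (le_of_eq ?_)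
    rw [norm_mul, Complex.norm_exp_ofReal_mul_I, Complex.norm_real, Complex.norm_real,
      Real.norm_of_nonneg (by linarith), Real.norm_of_nonneg (by positivity)]
    ring
  · have h3 : (-((θ : ℂ) ^ 2 / 2) * (q : ℂ)⁻¹) = ((-(θ ^ 2 / 2) * (q : ℝ)⁻¹ : ℝ) : ℂ) := by
      push_cast; ring
    rw [h3, Complex.norm_exp_ofReal, Real.exp_le_one_iff, neg_mul, neg_nonpos]
    positivity
  · set v : ℝ := (q : ℝ)⁻¹
    have hv : (q : ℂ)⁻¹ = (v : ℂ) := by simp [v]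
    have hv0 : 0 ≤ v := by positivity
    have hv2 : v ≤ 1 / 2 := by
      rw [one_div]
      exact inv_anti₀ two_pos (by exact_mod_cast (hQ q hq).two_le)
    rw [hv]
    set z : ℂ := (θ * Complex.I - θ ^ 2 / 2) * v
    have hz : ‖z‖ ≤ 2 * |θ| * v := by
      simp only [z]
      rw [norm_mul, Complex.norm_real, Real.norm_of_nonneg hv0]
      refine mul_le_mul_of_nonneg_right ((norm_sub_le _ _).trans ?_) hv0
      rw [norm_mul, Complex.norm_I, mul_one, Complex.norm_real, Real.norm_eq_abs, norm_div,
        norm_pow, Complex.norm_real, Real.norm_eq_abs, sq_abs]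
      simp only [Complex.norm_ofNat]
      linarith [abs_nonneg θ]
    have hz1 : ‖z‖ ≤ 1 := hz.trans (by nlinarith [abs_nonneg θ])
    have e1 : (1 + (Complex.exp (θ * Complex.I) - 1) * (v : ℂ)) *
          Complex.exp (-(θ * Complex.I) * v) - Complex.exp (-(θ ^ 2 / 2) * v) =
        ((Complex.exp (θ * Complex.I) - ∑ j ∈ range 3, (θ * Complex.I) ^ j / (j ! : ℂ)) * v -
          (Complex.exp z - 1 - z)) * Complex.exp (-(θ * Complex.I) * v) := by
      have e2 : Complex.exp (-(θ ^ 2 / 2) * v) =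
          Complex.exp z * Complex.exp (-(θ * Complex.I) * v) := by
        rw [← Complex.exp_add]; congr 1; simp only [z]; ring
      rw [e2, ← sub_mul]
      congr 1
      simp only [Finset.sum_range_succ, Finset.sum_range_zero, Nat.factorial, z, mul_pow,
        Complex.I_sq]
      push_cast
      ring
    have hv' : ‖Complex.exp (-(θ * Complex.I) * (v : ℂ))‖ = 1 := by rw [← hv]; exact hn1 q
    rw [e1, norm_mul, hv', mul_one]
    refine (norm_sub_le _ _).trans ?_
    rw [norm_mul, Complex.norm_real, Real.norm_of_nonneg hv0]
    have h5 := mul_le_mul_of_nonneg_right (norm_exp_mul_I_sub_sum_le θ 3) hv0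
    have h6 := Complex.norm_exp_sub_one_sub_id_le hz1
    have h7 : ‖z‖ ^ 2 ≤ v * (4 * θ ^ 2 * ε) := by
      calc ‖z‖ ^ 2 ≤ (2 * |θ| * v) ^ 2 := by gcongr
        _ = v * (4 * θ ^ 2 * v) := by rw [mul_pow, mul_pow, sq_abs]; ring
        _ ≤ _ := by
          have := hε q hq
          gcongr
    have h8 : |θ| ^ 3 / (3 ! : ℝ) ≤ |θ| ^ 3 :=
      div_le_self (by positivity) (by exact_mod_cast Nat.one_le_of_lt (Nat.factorial_pos 3))
    have h9 := mul_le_mul_of_nonneg_right h8 hv0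
    linarith

end Model

end ErdosKac

namespace ErdosKac

section Levy

open MeasureTheory ProbabilityTheory Topology
open scoped BigOperators ENNReal

/-- The standard Gaussian distribution function. -/
noncomputable def gaussianCDF (v : ℝ) : ℝ :=
  (√(2 * Real.pi))⁻¹ * ∫ t in Set.Iic v, Real.exp (-t ^ 2 / 2)

lemma integrable_exp_neg_sq_div_two : Integrable fun t : ℝ => Real.exp (-t ^ 2 / 2) := by
  have h := integrable_exp_neg_mul_sq (b := 1 / 2) (by norm_num)
  refine h.congr (ae_of_all _ fun t => ?_)
  simp only
  congr 1
  ring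

lemma continuous_gaussianCDF : Continuous gaussianCDF := by
  have h : gaussianCDF = fun v => (√(2 * Real.pi))⁻¹ *
      ((∫ t in Set.Iic (0 : ℝ), Real.exp (-t ^ 2 / 2)) + ∫ t in (0 : ℝ)..v,
        Real.exp (-t ^ 2 / 2)) := by
    funext v
    rw [gaussianCDF, ← intervalIntegral.integral_Iic_sub_Iic
      integrable_exp_neg_sq_div_two.integrableOn integrable_exp_neg_sq_div_two.integrableOn,
      add_sub_cancel]
  rw [h]
  exact continuous_const.mul (continuous_const.add
    (intervalIntegral.continuous_primitive (fun a b =>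
      integrable_exp_neg_sq_div_two.intervalIntegrable) 0))

lemma gaussianReal_real_Iic (v : ℝ) : (gaussianReal 0 1).real (Set.Iic v) = gaussianCDF v := by
  rw [measureReal_def, gaussianReal_apply_eq_integral _ one_ne_zero, ENNReal.toReal_ofReal
    (integral_nonneg fun t => gaussianPDFReal_nonneg _ _ _), gaussianCDF, ← integral_const_mul]
  simp [gaussianPDFReal_def]

variable {α : Type*}

/-- The uniform distribution on the values of `Y` on `s`. -/
noncomputable def empirical (s : Finset α) (Y : α → ℝ) : Measure ℝ :=
  (s.card : ℝ≥0∞)⁻¹ • ∑ i ∈ s, Measure.dirac (Y i)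

lemma isProbabilityMeasure_empirical {s : Finset α} (hs : s.Nonempty) (Y : α → ℝ) :
    IsProbabilityMeasure (empirical s Y) := by
  refine ⟨?_⟩
  have h0 : (s.card : ℝ≥0∞) ≠ 0 := by exact_mod_cast hs.card_pos.ne'
  simp [empirical, ENNReal.inv_mul_cancel h0]

lemma charFun_empirical (s : Finset α) (Y : α → ℝ) (t : ℝ) :
    charFun (empirical s Y) t = 𝔼 i ∈ s, Complex.exp (t * Y i * Complex.I) := by
  rw [charFun_apply_real, empirical, integral_smul_measure, integral_finsetSum_measure
    (fun i _ => integrable_dirac (by simp))]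
  simp [Finset.expect_eq_sum_div_card, div_eq_inv_mul]

lemma empirical_real_Iic (s : Finset α) (Y : α → ℝ) (v : ℝ) :
    (empirical s Y).real (Set.Iic v) = ((s.filter fun i => Y i ≤ v).card : ℝ) / s.card := by
  simp [empirical, measureReal_def, Set.indicator_apply, div_eq_inv_mul]

/-- Lévy's continuity theorem for uniform averages over finite sets. -/
lemma tendsto_card_le_div_card {s : ℝ → Finset α} {Y : ℝ → α → ℝ}
    (hs : ∀ᶠ a in atTop, (s a).Nonempty)
    (h : ∀ t : ℝ, Tendsto (fun a => 𝔼 i ∈ s a, Complex.exp (t * Y a i * Complex.I)) atTop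
      (𝓝 (Complex.exp (-t ^ 2 / 2)))) (v : ℝ) :
    Tendsto (fun a => (((s a).filter fun i => Y a i ≤ v).card : ℝ) / (s a).card) atTop
      (𝓝 (gaussianCDF v)) := by
  classical
  rw [tendsto_iff_seq_tendsto]
  intro a ha
  have hprob (n : ℕ) : IsProbabilityMeasure
      (if (s (a n)).Nonempty then empirical (s (a n)) (Y (a n)) else Measure.dirac 0) := by
    split_ifs with hn
    · exact isProbabilityMeasure_empirical hn _
    · infer_instance
  set ν : ℕ → ProbabilityMeasure ℝ := fun n => ⟨_, hprob n⟩
  have hν : ∀ᶠ n in atTop, (ν n : Measure ℝ) = empirical (s (a n)) (Y (a n)) := by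
    filter_upwards [ha.eventually hs] with n hn
    simp [ν, hn]
  set ν₀ : ProbabilityMeasure ℝ := ⟨gaussianReal 0 1, inferInstance⟩
  have hlim : Tendsto ν atTop (𝓝 ν₀) := by
    refine ProbabilityMeasure.tendsto_of_tendsto_charFun fun t => ?_
    have h1 : charFun (ν₀ : Measure ℝ) t = Complex.exp (-t ^ 2 / 2) := by
      simp [ν₀, charFun_gaussianReal, neg_div]
    rw [h1]
    refine ((h t).comp ha).congr' ?_
    filter_upwards [hν] with n hn
    rw [hn, charFun_empirical]
    rfl
  have h2 := ProbabilityMeasure.tendsto_measure_of_null_frontier_of_tendsto' hlim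
    (E := Set.Iic v) (by
      rw [frontier_Iic]
      have := nullSingletonClass_gaussianReal (μ := 0) (v := 1) one_ne_zero
      exact measure_singleton (μ := gaussianReal 0 1) v)
  have h3 := (ENNReal.tendsto_toReal (measure_ne_top (ν₀ : Measure ℝ) (Set.Iic v))).comp h2
  have h4 : ((ν₀ : Measure ℝ) (Set.Iic v)).toReal = gaussianCDF v := gaussianReal_real_Iic v
  rw [h4] at h3
  refine h3.congr' ?_
  filter_upwards [hν] with n hn
  simp only [Function.comp]
  rw [hn]
  exact empirical_real_Iic _ _ _

end Levy

end ErdosKac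

namespace ErdosKac

section Beta

open Finset Real

/-- The sum of the distinct prime divisors of `n`. -/
def sumPrimeFactors (n : ℕ) : ℕ := ∑ p ∈ n.primeFactors, p

lemma sumPrimeFactors_mul_mul (m p q : ℕ) (hm : 0 < m) (hp : p.Prime) (hq : q.Prime)
    (hpq : p ≠ q) (hpm : ¬ p ∣ m) (hqm : ¬ q ∣ m) :
    sumPrimeFactors (m * p * q) = sumPrimeFactors m + p + q := by
  have h1 : ¬ q ∣ m * p := fun h => (hq.dvd_mul.1 h).elim hqm
    fun h => hpq ((Nat.prime_dvd_prime_iff_eq hq hp).1 h).symm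
  have aux : ∀ n r : ℕ, n ≠ 0 → r.Prime → ¬ r ∣ n →
      sumPrimeFactors (n * r) = sumPrimeFactors n + r := by
    intro n r hn hr hrn
    rw [sumPrimeFactors, Nat.primeFactors_mul hn hr.ne_zero, hr.primeFactors,
      Finset.sum_union (by simpa using fun _ h => absurd h hrn), Finset.sum_singleton,
      sumPrimeFactors]
  rw [aux _ _ (Nat.mul_ne_zero hm.ne' hp.ne_zero) hq h1, aux _ _ hm.ne' hp hpm]

lemma sumPrimeFactors_pos {n : ℕ} (hn : 2 ≤ n) : 0 < sumPrimeFactors n := by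
  obtain ⟨p, hp, hpn⟩ := Nat.exists_prime_and_dvd (show n ≠ 1 by omega)
  exact Finset.sum_pos (fun q hq => (Nat.prime_of_mem_primeFactors hq).pos)
    ⟨p, Nat.mem_primeFactors.2 ⟨hp, hpn, by omega⟩⟩

lemma sumPrimeFactors_le (n : ℕ) : sumPrimeFactors n ≤ n ^ 2 := by
  have h1 : n.primeFactors ⊆ Icc 1 n := fun p hp => Finset.mem_Icc.2
    ⟨(Nat.prime_of_mem_primeFactors hp).pos, Nat.le_of_mem_primeFactors hp⟩
  have h2 := (Finset.card_le_card h1).trans (by rw [Nat.card_Icc, Nat.add_sub_cancel])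
  calc sumPrimeFactors n ≤ #n.primeFactors • n :=
        Finset.sum_le_card_nsmul _ _ _ fun p hp => Nat.le_of_mem_primeFactors hp
    _ ≤ n * n := Nat.mul_le_mul_right _ h2
    _ = n ^ 2 := (sq n).symm

/-- The number of large prime factors of an integer. -/
lemma card_large_primeFactors_le {N : ℕ} (hN : N ≠ 0) {w : ℝ} (hw : 1 < w) :
    (#(N.primeFactors.filter fun p : ℕ => w < p) : ℝ) ≤ log N / log w := by
  rw [le_div_iff₀ (Real.log_pos hw), ← Real.log_pow]
  refine Real.log_le_log (by positivity) ?_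
  calc w ^ #(N.primeFactors.filter fun p : ℕ => w < p)
      ≤ ∏ p ∈ N.primeFactors.filter (fun p : ℕ => w < p), (p : ℝ) := by
        rw [← Finset.prod_const]
        exact Finset.prod_le_prod (fun _ _ => by positivity)
          fun p hp => (Finset.mem_filter.1 hp).2.le
    _ ≤ N := by
        rw [← Nat.cast_prod]
        exact_mod_cast Nat.le_of_dvd (Nat.pos_of_ne_zero hN)
          ((Finset.prod_dvd_prod_of_subset _ _ _ (Finset.filter_subset _ _)).trans
            (Nat.prod_primeFactors_dvd N))

end Beta

section Scale

open Finset Real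
open scoped BigOperators

variable {x T Z D₀ w : ℝ} {I Q : Finset ℕ} {k : ℕ} {f : ℕ → ℕ}

/-- The sieve error on triples. -/
lemma sieveError_triples_le (hx : 0 < x) (hT : 0 < T) (hD₀ : 0 < D₀) (hw : 1 ≤ w) (hZ : 1 ≤ Z)
    (hI : ∀ p ∈ I, w ^ (4 * k) ≤ p ∧ (p : ℝ) ≤ Z)
    (hQ : ∀ q ∈ Q, q.Prime ∧ D₀ ≤ q ∧ (q : ℝ) ≤ w)
    (hcard : x / 2 ≤ #(triples x T I)) :
    sieveError Q k (triples x T I) (tripleVal f) ≤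
      12 * (T * log Z + 1) ^ 2 * ((1 + k * log w) / D₀) := by
  set D := ⌊w ^ k⌋₊
  have hwk : 1 ≤ w ^ k := one_le_pow₀ hw
  have hD : 1 ≤ D := Nat.le_floor (by exact_mod_cast hwk)
  have hDw : (D : ℝ) ≤ w ^ k := Nat.floor_le (by positivity)
  have hprime (A : Finset ℕ) (hA : A ⊆ Q) : ∀ q ∈ A, q.Prime := fun q hq => (hQ q (hA hq)).1
  set 𝒟 := (Q.powerset.filter (#· ≤ k)).image fun A => ∏ q ∈ A, q
  have hinj : Set.InjOn (fun A : Finset ℕ => ∏ q ∈ A, q) (Q.powerset.filter (#· ≤ k)) := by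
    intro A hA B hB hAB
    have hA := Finset.mem_powerset.1 (Finset.mem_filter.1 hA).1
    have hB := Finset.mem_powerset.1 (Finset.mem_filter.1 hB).1
    rw [← Nat.primeFactors_prod (hprime A hA), ← Nat.primeFactors_prod (hprime B hB)]
    exact congrArg _ hAB
  have hI4 : ∀ p ∈ I, D ^ 4 ≤ p := by
    intro p hp
    have h1 : (D : ℝ) ^ 4 ≤ p := by
      refine le_trans ?_ (hI p hp).1
      rw [mul_comm, pow_mul]
      gcongr
    exact_mod_cast h1
  have h𝒟 : ∀ d ∈ 𝒟, 0 < d ∧ d ≤ D := by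
    intro d hd
    obtain ⟨A, hA, rfl⟩ := Finset.mem_image.1 hd
    obtain ⟨hA, hAk⟩ := Finset.mem_filter.1 hA
    have hA := Finset.mem_powerset.1 hA
    refine ⟨prod_pos_of_prime (hprime A hA), Nat.le_floor ?_⟩
    push_cast
    calc ∏ q ∈ A, (q : ℝ) ≤ ∏ q ∈ A, w :=
          Finset.prod_le_prod (fun _ _ => by positivity) fun q hq => (hQ q (hA hq)).2.2
      _ = w ^ #A := Finset.prod_const _
      _ ≤ w ^ k := pow_le_pow_right₀ hw hAk
  have h𝒟' : ∀ d ∈ 𝒟, ∀ e, e ∣ d → e ≠ 1 → D₀ ≤ e := by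
    intro d hd e hed he
    obtain ⟨A, hA, rfl⟩ := Finset.mem_image.1 hd
    have hA := Finset.mem_powerset.1 (Finset.mem_filter.1 hA).1
    obtain ⟨p, hp, hpe⟩ := Nat.exists_prime_and_dvd he
    obtain ⟨q, hq, hpq⟩ := (hp.prime.dvd_finsetProd_iff _).1 (hpe.trans hed)
    rw [(Nat.prime_dvd_prime_iff_eq hp (hprime A hA q hq)).1 hpq] at hpe
    have he0 : 0 < e := Nat.pos_of_dvd_of_pos hed (prod_pos_of_prime (hprime A hA))
    exact (hQ q (hA hq)).2.1.trans (by exact_mod_cast Nat.le_of_dvd he0 hpe)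
  have hmain := sum_abs_card_dvd_sub_le hx.le hT hD₀ hD hI4 h𝒟 h𝒟' f
  set s := triples x T I
  have hs0 : 0 < (#s : ℝ) := lt_of_lt_of_le (by positivity) hcard
  have heq : sieveError Q k s (tripleVal f) = (∑ d ∈ 𝒟,
      |(#(s.filter fun t => d ∣ tripleVal f t) : ℝ) - #s / d|) / #s := by
    rw [Finset.sum_image hinj, sieveError, Finset.sum_div]
    refine Finset.sum_congr rfl fun A _ => ?_
    rw [Finset.expect_eq_sum_div_card, Finset.sum_boole]
    nth_rewrite 3 [← abs_of_pos hs0]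
    rw [← abs_div, sub_div]
    congr 2
    field_simp
  have hI1 : ∀ p ∈ I, 0 < p ∧ (p : ℝ) ≤ Z := fun p hp =>
    ⟨lt_of_lt_of_le (by positivity) (hI4 p hp), (hI p hp).2⟩
  have hcell := card_image_cell_le hT hI1 hZ
  have hlog : log D ≤ k * log w := by
    rw [← Real.log_pow]
    exact Real.log_le_log (by exact_mod_cast hD) hDw
  have hlogD : 0 ≤ log D := Real.log_natCast_nonneg D
  rw [heq, div_le_iff₀ hs0]
  refine hmain.trans ?_
  calc x * (6 * (#(I.image (cell T)) : ℝ) ^ 2) * ((1 + log D) / D₀)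
      ≤ (2 * #s) * (6 * (T * log Z + 1) ^ 2) * ((1 + k * log w) / D₀) := by
        gcongr
        linarith
    _ = _ := by ring

lemma expect_model_omegaIn (hQ : ∀ q ∈ Q, q.Prime) :
    𝔼 n ∈ Ioc 0 (∏ q ∈ Q, q), (omegaIn Q n : ℝ) = ∑ q ∈ Q, (q : ℝ)⁻¹ := by
  simp only [omegaIn_eq_sum, Finset.expect_sum_comm]
  exact Finset.sum_congr rfl fun q hq =>
    expect_dvd (prod_pos_of_prime hQ) (Finset.dvd_prod_of_mem _ hq)

/-- Markov's inequality for the number of prime factors in `Q`. -/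
lemma card_le_omegaIn_le {α : Type*} {s : Finset α} {b : α → ℕ} (hQ : ∀ q ∈ Q, q.Prime) {A : ℝ}
    (hA : 0 < A) :
    (#(s.filter fun t => A ≤ omegaIn Q (b t)) : ℝ) / #s ≤
      (∑ q ∈ Q, (q : ℝ)⁻¹ + sieveError Q 1 s b) / A := by
  have h1 : |(𝔼 t ∈ s, (omegaIn Q (b t) : ℝ)) - ∑ q ∈ Q, (q : ℝ)⁻¹| ≤ sieveError Q 1 s b := by
    have h := abs_expect_omegaIn_pow_sub_le (s := s) (b := b) (c := id)
      (r := Ioc 0 (∏ q ∈ Q, q)) hQ (le_refl 1)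
    rw [sieveError_model hQ, add_zero, Nat.cast_one, one_pow, one_mul] at h
    rw [← expect_model_omegaIn hQ]
    simp only [pow_one] at h
    exact h
  have h2 := (abs_le.1 h1).2
  rw [le_div_iff₀ hA]
  have h3 : (#(s.filter fun t => A ≤ omegaIn Q (b t)) : ℝ) / #s * A ≤
      𝔼 t ∈ s, (omegaIn Q (b t) : ℝ) := by
    rw [Finset.expect_eq_sum_div_card, div_mul_eq_mul_div]
    gcongr
    rw [← nsmul_eq_mul, ← Finset.sum_const]
    refine (Finset.sum_le_sum fun t ht => (Finset.mem_filter.1 ht).2).trans ?_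
    exact Finset.sum_le_sum_of_subset_of_nonneg (Finset.filter_subset _ _)
      fun _ _ _ => Nat.cast_nonneg _
  linarith

/-- Frequencies of events over integers and over triples agree. -/
lemma abs_card_div_sub_card_div_le (hx : 1 ≤ x) (hT : 0 < T)
    (hI : ∀ p ∈ I, p.Prime ∧ k < p ∧ (p : ℝ) ≤ x) (hE : 1 ≤ ∑ p ∈ I, (p : ℝ)⁻¹)
    (herr : comparisonError x T (∑ p ∈ I, (p : ℝ)⁻¹) k ≤ 1 / 2) (P : ℕ → Prop)
    [DecidablePred P] :
    |(#((Icc 1 ⌊x⌋₊).filter fun n => P (sumPrimeFactors n)) : ℝ) / x -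
      #((triples x T I).filter fun t => P (tripleVal sumPrimeFactors t)) / #(triples x T I)| ≤
      comparisonError x T (∑ p ∈ I, (p : ℝ)⁻¹) k := by
  have h := (norm_average_sub_average_le hx hT hI hE
    (fun m p q hm hp hq => sumPrimeFactors_mul_mul m p q hm hp hq) herr).2
    (fun n => if P n then 1 else 0) (fun n => by split_ifs <;> simp)
  rw [Finset.sum_boole, Finset.sum_boole] at h
  rw [← Real.norm_eq_abs, ← Complex.norm_real]
  push_cast
  exact h

end Scale

end ErdosKac

namespace ErdosKac

section MediumPrimes

open Finset Real
open scoped Topology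

lemma comparisonError_le {x T E x₀ E₀ y : ℝ} {k : ℕ} (hE₀ : 0 < E₀) (hE : E₀ ≤ E) (hx₀ : 0 < x₀)
    (hx : x₀ ≤ x) (hy : 0 < y) (hk : y ≤ k + 1) :
    comparisonError x T E k ≤ 32 / √E₀ + 8 / T + 5 / x₀ + 4 / y := by
  have h : 0 < √E₀ := Real.sqrt_pos.2 hE₀
  unfold comparisonError
  gcongr

/-- The sum of the prime divisors of a typical integer has few prime factors between
`H ^ 8` and `exp (4 * H)`. -/
lemma eventually_card_le_omegaIn_le {ε : ℝ} (hε : 0 < ε) :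
    ∀ᶠ H : ℝ in atTop, ∀ x, exp (H ^ 2) ≤ x → ∀ A, 0 < A →
      (#((Icc 1 ⌊x⌋₊).filter fun n =>
        A ≤ (omegaIn (primesIoc (H ^ 8) (exp (4 * H))) (sumPrimeFactors n) : ℝ)) : ℝ) / x ≤
      ε + 2 * log H / A := by
  obtain ⟨C, hC, hM⟩ := exists_abs_sum_inv_primesIoc_sub_le
  have hlim : Tendsto (fun H : ℝ => 32 / √(log H - (log 16 + C)) + 8 / H + 5 / exp (H ^ 2) +
      4 / exp (16 * H)) atTop (𝓝 (0 + 0 + 0 + 0)) := by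
    refine ((Tendsto.add ?_ ?_).add ?_).add ?_
    · exact (Real.tendsto_sqrt_atTop.comp
        (tendsto_atTop_add_const_right _ _ Real.tendsto_log_atTop)).const_div_atTop _
    · exact tendsto_id.const_div_atTop _
    · exact (Real.tendsto_exp_atTop.comp (tendsto_pow_atTop two_ne_zero)).const_div_atTop _
    · exact (Real.tendsto_exp_atTop.comp
        (tendsto_id.const_mul_atTop (by norm_num))).const_div_atTop _
  have hsmall := hlim.eventually_lt_const (u := min ε (1 / 2)) (by simp [hε])
  filter_upwards [hsmall, eventually_ge_atTop 240,
    Real.tendsto_log_atTop.eventually_ge_atTop (log 16 + C + 1)] with H herr hH hlog x hx A hA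
  have hH0 : 0 < H := by linarith
  have hl4 : 0 < log 4 := Real.log_pos (by norm_num)
  have hl16 : 0 < log 16 := Real.log_pos (by norm_num)
  set I := primesIoc (exp (16 * H)) (exp (H ^ 2))
  set Q := primesIoc (H ^ 8) (exp (4 * H))
  set k := ⌊exp (16 * H)⌋₊
  have hmemI (p : ℕ) : p ∈ I ↔ p.Prime ∧ exp (16 * H) < p ∧ (p : ℝ) ≤ exp (H ^ 2) :=
    mem_primesIoc (exp_pos _).le (exp_pos _).le
  have hmemQ (p : ℕ) : p ∈ Q ↔ p.Prime ∧ H ^ 8 < p ∧ (p : ℝ) ≤ exp (4 * H) :=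
    mem_primesIoc (by positivity) (exp_pos _).le
  have hE : log H - (log 16 + C) ≤ ∑ p ∈ I, (p : ℝ)⁻¹ := by
    have h := (abs_le.1 (hM (exp (16 * H)) (exp (H ^ 2)) (by
      have := Real.add_one_le_exp (16 * H); linarith) (Real.exp_le_exp.2 (by nlinarith)))).1
    rw [Real.log_exp, Real.log_exp, Real.log_pow, Real.log_mul (by norm_num) hH0.ne'] at h
    push_cast at h
    linarith
  have hμ : ∑ q ∈ Q, (q : ℝ)⁻¹ + 1 ≤ 2 * log H := by
    by_cases hle : H ^ 8 ≤ exp (4 * H)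
    · have h := (abs_le.1 (hM (H ^ 8) (exp (4 * H)) (by
        have : (1 : ℝ) ≤ H ^ 7 := one_le_pow₀ (by linarith)
        nlinarith) hle)).2
      rw [Real.log_exp, Real.log_pow, Real.log_mul (by norm_num) hH0.ne'] at h
      push_cast at h
      have h1 : 0 ≤ log (8 * log H) := Real.log_nonneg (by linarith)
      have h2 : log 4 ≤ log 16 := Real.log_le_log (by norm_num) (by norm_num)
      linarith
    · have : Q = ∅ := Finset.eq_empty_of_forall_notMem fun q hq => by
        obtain ⟨-, h1, h2⟩ := (hmemQ q).1 hq
        linarith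
      rw [this, Finset.sum_empty]
      linarith
  have hcomp : comparisonError x H (∑ p ∈ I, (p : ℝ)⁻¹) k ≤ min ε (1 / 2) :=
    (comparisonError_le (by linarith) hE (exp_pos _) hx (exp_pos _)
      (Nat.lt_floor_add_one _).le).trans herr.le
  have hx1 : 1 ≤ x := (Real.one_le_exp (by positivity)).trans hx
  have hIk : ∀ p ∈ I, p.Prime ∧ k < p ∧ (p : ℝ) ≤ x := fun p hp => by
    obtain ⟨h1, h2, h3⟩ := (hmemI p).1 hp
    exact ⟨h1, (Nat.floor_lt (exp_pos _).le).2 h2, h3.trans hx⟩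
  have hE1 : 1 ≤ ∑ p ∈ I, (p : ℝ)⁻¹ := by linarith
  have hcomp2 := hcomp.trans (min_le_right _ _)
  have hcard := (norm_average_sub_average_le hx1 hH0 hIk hE1
    (fun m p q hm hp hq => sumPrimeFactors_mul_mul m p q hm hp hq) hcomp2).1
  have hη : sieveError Q 1 (triples x H I) (tripleVal sumPrimeFactors) ≤ 1 := by
    refine (sieveError_triples_le (w := exp (4 * H)) (Z := exp (H ^ 2)) (D₀ := H ^ 8)
      (by linarith) hH0 (by positivity) (Real.one_le_exp (by positivity))
      (Real.one_le_exp (by positivity)) (fun p hp => ?_) (fun q hq => ?_) hcard).trans ?_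
    · obtain ⟨-, h2, h3⟩ := (hmemI p).1 hp
      refine ⟨?_, h3⟩
      rw [← Real.exp_nat_mul]
      refine le_trans (le_of_eq ?_) h2.le
      congr 1
      push_cast
      ring
    · obtain ⟨h1, h2, h3⟩ := (hmemQ q).1 hq
      exact ⟨h1, h2.le, h3⟩
    · rw [Real.log_exp, Real.log_exp, Nat.cast_one, one_mul, ← mul_div_assoc,
        div_le_one (by positivity)]
      have h3 : 1 ≤ H ^ 3 := one_le_pow₀ (by linarith)
      calc 12 * (H * H ^ 2 + 1) ^ 2 * (1 + 4 * H)
          ≤ 12 * (2 * H ^ 3) ^ 2 * (5 * H) := by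
            gcongr
            · linarith
            · linarith
        _ = 240 * H ^ 7 := by ring
        _ ≤ H * H ^ 7 := by gcongr
        _ = H ^ 8 := by ring
  have h1 := (abs_le.1 (abs_card_div_sub_card_div_le hx1 hH0 hIk hE1 hcomp2
    (fun n => A ≤ (omegaIn Q n : ℝ)))).2
  have h2 := card_le_omegaIn_le (s := triples x H I) (b := tripleVal sumPrimeFactors)
    (fun q hq => ((hmemQ q).1 hq).1) hA
  have h3 : (∑ q ∈ Q, (q : ℝ)⁻¹ + sieveError Q 1 (triples x H I) (tripleVal sumPrimeFactors)) / A
      ≤ 2 * log H / A := by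
    gcongr
    linarith
  have h4 := hcomp.trans (min_le_left _ _)
  linarith

end MediumPrimes

end ErdosKac

namespace ErdosKac

section MainScale

open Finset Real
open scoped Topology BigOperators

/-- The length of the main interval, so that `a ^ 8` is its iterated logarithm. -/
noncomputable def mainX (a : ℝ) : ℝ := exp (exp (a ^ 8))

/-- The large primes used to perturb a typical integer. -/
noncomputable def mainI (a : ℝ) : Finset ℕ := primesIoc (exp (exp (a ^ 8) / a)) (mainX a)

/-- The primes that carry the limit law. -/
noncomputable def mainQ (a : ℝ) : Finset ℕ :=
  primesIoc (exp (4 * a ^ 8)) (exp (exp (a ^ 8) / a ^ 2))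

/-- The mean value of the number of prime factors from `mainQ a`. -/
noncomputable def mainMean (a : ℝ) : ℝ := ∑ q ∈ mainQ a, (q : ℝ)⁻¹

/-- The triples at the main scale. -/
noncomputable def mainTriples (a : ℝ) : Finset (ℕ × ℕ × ℕ) := triples (mainX a) a (mainI a)

/-- The error in the passage from integers to triples at the main scale. -/
noncomputable def mainError (a : ℝ) : ℝ :=
  comparisonError (mainX a) a (∑ p ∈ mainI a, (p : ℝ)⁻¹) ⌊exp (exp (a ^ 8) / a)⌋₊

lemma mem_mainI {a : ℝ} {p : ℕ} :
    p ∈ mainI a ↔ p.Prime ∧ exp (exp (a ^ 8) / a) < p ∧ (p : ℝ) ≤ mainX a :=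
  mem_primesIoc (exp_pos _).le (exp_pos _).le

lemma mem_mainQ {a : ℝ} {q : ℕ} :
    q ∈ mainQ a ↔ q.Prime ∧ exp (4 * a ^ 8) < q ∧ (q : ℝ) ≤ exp (exp (a ^ 8) / a ^ 2) :=
  mem_primesIoc (exp_pos _).le (exp_pos _).le

lemma le_exp_pow_eight {a : ℝ} (ha : 2 ≤ a) : 4 * a ^ 10 ≤ exp (a ^ 8) := by
  have h := Real.quadratic_le_exp_of_nonneg (x := a ^ 8) (by positivity)
  have h6 : (2 : ℝ) ^ 6 ≤ a ^ 6 := by gcongr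
  have h10 : 0 < a ^ 10 := by positivity
  have h8 : 0 < a ^ 8 := by positivity
  nlinarith

lemma le_exp_pow_eight_div {a : ℝ} (ha : 2 ≤ a) : a ≤ exp (a ^ 8) / a := by
  rw [le_div_iff₀ (by linarith)]
  refine le_trans ?_ (le_exp_pow_eight ha)
  have : 1 ≤ a ^ 8 := one_le_pow₀ (by linarith)
  nlinarith [sq_nonneg a]

lemma eventually_abs_mainMean_sub_le : ∀ᶠ a : ℝ in atTop, |mainMean a - a ^ 8| ≤ a ^ 2 := by
  obtain ⟨C, hC, hM⟩ := exists_abs_sum_inv_primesIoc_sub_le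
  filter_upwards [eventually_ge_atTop (11 + log 4 + C)] with a ha
  have h4 : 0 < log 4 := Real.log_pos (by norm_num)
  have ha2 : 2 ≤ a := by linarith
  have ha0 : 0 < a := by linarith
  have h8 : 1 ≤ a ^ 8 := one_le_pow₀ (by linarith)
  have h := hM (exp (4 * a ^ 8)) (exp (exp (a ^ 8) / a ^ 2))
    (by have := Real.add_one_le_exp (4 * a ^ 8); linarith) (by
      rw [Real.exp_le_exp, le_div_iff₀ (by positivity)]
      exact (le_of_eq (by ring)).trans (le_exp_pow_eight ha2))
  rw [Real.log_exp, Real.log_exp, Real.log_div (exp_pos _).ne' (by positivity), Real.log_exp,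
    Real.log_pow, Real.log_mul (by norm_num) (by positivity), Real.log_pow] at h
  push_cast at h
  change |mainMean a - (a ^ 8 - 2 * log a - (log 4 + 8 * log a))| ≤ C at h
  have h1 := Real.log_le_sub_one_of_pos ha0
  have h2 : 0 ≤ log a := Real.log_nonneg (by linarith)
  rw [abs_le] at h ⊢
  constructor <;> nlinarith

lemma eventually_le_sum_mainI :
    ∃ C, ∀ᶠ a : ℝ in atTop, log a - C ≤ ∑ p ∈ mainI a, (p : ℝ)⁻¹ := by
  obtain ⟨C, hC, hM⟩ := exists_abs_sum_inv_primesIoc_sub_le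
  refine ⟨C, ?_⟩
  filter_upwards [eventually_ge_atTop 2] with a ha2
  have ha0 : 0 < a := by linarith
  have h := (abs_le.1 (hM (exp (exp (a ^ 8) / a)) (mainX a)
    (by have := Real.add_one_le_exp (exp (a ^ 8) / a)
        have := le_exp_pow_eight_div ha2
        linarith)
    (Real.exp_le_exp.2 (div_le_self (exp_pos _).le (by linarith))))).1
  rw [mainX, Real.log_exp, Real.log_exp, Real.log_exp, Real.log_div (exp_pos _).ne' (by positivity),
    Real.log_exp] at h
  change -C ≤ ∑ p ∈ mainI a, (p : ℝ)⁻¹ - (a ^ 8 - (a ^ 8 - log a)) at h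
  linarith

lemma eventually_one_le_sum_mainI : ∀ᶠ a : ℝ in atTop, 1 ≤ ∑ p ∈ mainI a, (p : ℝ)⁻¹ := by
  obtain ⟨C, hC⟩ := eventually_le_sum_mainI
  filter_upwards [hC, Real.tendsto_log_atTop.eventually_ge_atTop (C + 1)] with a h1 h2
  linarith

lemma exp_le_mainX {a : ℝ} (ha : 2 ≤ a) : exp a ≤ mainX a :=
  Real.exp_le_exp.2 ((le_exp_pow_eight_div ha).trans
    (div_le_self (exp_pos _).le (by linarith)))

lemma tendsto_mainError : Tendsto mainError atTop (𝓝 0) := by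
  obtain ⟨C, hC⟩ := eventually_le_sum_mainI
  have hlim : Tendsto (fun a : ℝ => 32 / √(log a - C) + 8 / a + 5 / exp a + 4 / exp a) atTop
      (𝓝 (0 + 0 + 0 + 0)) := by
    refine ((Tendsto.add ?_ ?_).add ?_).add ?_
    · exact (Real.tendsto_sqrt_atTop.comp
        (tendsto_atTop_add_const_right _ _ Real.tendsto_log_atTop)).const_div_atTop _
    · exact tendsto_id.const_div_atTop _
    · exact Real.tendsto_exp_atTop.const_div_atTop _
    · exact Real.tendsto_exp_atTop.const_div_atTop _
  rw [add_zero, add_zero, add_zero] at hlim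
  refine squeeze_zero' ?_ ?_ hlim
  · filter_upwards [eventually_gt_atTop 0] with a ha
    have : 0 < mainX a := exp_pos _
    unfold mainError comparisonError
    positivity
  · filter_upwards [hC, Real.tendsto_log_atTop.eventually_ge_atTop (C + 1),
      eventually_ge_atTop 2] with a h1 h2 ha
    refine comparisonError_le (by linarith) h1 (exp_pos _) (exp_le_mainX ha) (exp_pos _) ?_
    exact (Real.exp_le_exp.2 (le_exp_pow_eight_div ha)).trans (Nat.lt_floor_add_one _).le

lemma mem_mainI_bounds {a : ℝ} {p : ℕ} (hp : p ∈ mainI a) :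
    p.Prime ∧ ⌊exp (exp (a ^ 8) / a)⌋₊ < p ∧ (p : ℝ) ≤ mainX a := by
  obtain ⟨h1, h2, h3⟩ := mem_mainI.1 hp
  exact ⟨h1, (Nat.floor_lt (exp_pos _).le).2 h2, h3⟩

lemma eventually_le_card_mainTriples :
    ∀ᶠ a : ℝ in atTop, mainX a / 2 ≤ #(mainTriples a) := by
  filter_upwards [eventually_ge_atTop 2, eventually_one_le_sum_mainI,
    tendsto_mainError.eventually_le_const (u := 1 / 2) (by norm_num)] with a ha hE herr
  exact (norm_average_sub_average_le (Real.one_le_exp (exp_pos _).le) (by linarith)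
    (fun p hp => mem_mainI_bounds hp) hE
    (fun m p q hm hp hq => sumPrimeFactors_mul_mul m p q hm hp hq) herr).1

lemma eventually_sieveError_le {k : ℕ} (hk : 1 ≤ k) :
    ∀ᶠ a : ℝ in atTop, sieveError (mainQ a) k (mainTriples a) (tripleVal sumPrimeFactors) ≤
      96 * k * (a ^ 2 * exp (-a ^ 8)) := by
  filter_upwards [eventually_ge_atTop 2, eventually_ge_atTop (4 * k : ℝ),
    eventually_le_card_mainTriples] with a ha hak hcard
  have ha0 : 0 < a := by linarith
  have hk' : (1 : ℝ) ≤ k := by exact_mod_cast hk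
  refine (sieveError_triples_le (w := exp (exp (a ^ 8) / a ^ 2)) (Z := mainX a)
      (D₀ := exp (4 * a ^ 8)) (exp_pos _) ha0 (exp_pos _) (Real.one_le_exp (by positivity))
      (Real.one_le_exp (by positivity)) (fun p hp => ?_) (fun q hq => ?_) hcard).trans ?_
  · obtain ⟨-, h2, h3⟩ := mem_mainI.1 hp
    refine ⟨le_trans ?_ h2.le, h3⟩
    rw [← Real.exp_nat_mul, Real.exp_le_exp, ← mul_div_assoc, div_le_div_iff₀ (by positivity) ha0]
    push_cast
    calc 4 * k * exp (a ^ 8) * a ≤ a * exp (a ^ 8) * a := by gcongr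
      _ = exp (a ^ 8) * a ^ 2 := by ring
  · obtain ⟨h1, h2, h3⟩ := mem_mainQ.1 hq
    exact ⟨h1, h2.le, h3⟩
  · rw [mainX, Real.log_exp, Real.log_exp]
    have hl : 1 ≤ exp (a ^ 8) := Real.one_le_exp (by positivity)
    have h4 : exp (4 * a ^ 8) = exp (a ^ 8) ^ 4 := by
      rw [← Real.exp_nat_mul]
      push_cast
      ring_nf
    rw [h4, Real.exp_neg]
    set l := exp (a ^ 8)
    have h1 : a * l + 1 ≤ 2 * (a * l) := by nlinarith
    have h2 : 1 + k * (l / a ^ 2) ≤ 2 * (k * l) := by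
      have h3 : l / a ^ 2 ≤ l := div_le_self (by linarith) (one_le_pow₀ (by linarith))
      have h5 : k * (l / a ^ 2) ≤ k * l := by gcongr
      nlinarith
    calc 12 * (a * l + 1) ^ 2 * ((1 + k * (l / a ^ 2)) / l ^ 4)
        ≤ 12 * (2 * (a * l)) ^ 2 * ((2 * (k * l)) / l ^ 4) := by gcongr
      _ = 96 * k * (a ^ 2 * l⁻¹) := by
        field_simp
        ring

end MainScale

end ErdosKac

namespace ErdosKac

section CharFun

open Finset Real
open scoped Topology BigOperators

/-- The normalized number of prime factors from `mainQ a`. -/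
noncomputable def mainY (a : ℝ) (n : ℕ) : ℝ := ((omegaIn (mainQ a) n : ℝ) - mainMean a) / a ^ 4

lemma eventually_norm_charFun_sub_le (t : ℝ) {k : ℕ} (hk : Even k) (hk1 : 1 ≤ k) :
    ∀ᶠ a : ℝ in atTop, ‖(𝔼 i ∈ mainTriples a,
        Complex.exp (t * mainY a (tripleVal sumPrimeFactors i) * Complex.I)) -
        Complex.exp (-((t / a ^ 4) ^ 2 * mainMean a / 2 : ℝ))‖ ≤
      96 * k * exp (-a) + 4 * (1 / 2) ^ k * exp (2 * (2 * |t| + 1) ^ 2) +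
        (2 * |t| ^ 3 / a + 8 * t ^ 2 * exp (-a)) := by
  filter_upwards [eventually_ge_atTop (2 * k * |t| + 2 * |t| + 2),
    eventually_abs_mainMean_sub_le, eventually_sieveError_le hk1] with a ha hmean hsieve
  have ht := abs_nonneg t
  have hkt : 0 ≤ k * |t| := by positivity
  have ha2 : 2 ≤ a := by linarith
  have ha0 : 0 < a := by linarith
  obtain ⟨b, hb⟩ : ∃ b, b = a ^ 4 := ⟨_, rfl⟩
  have h8 : a ^ 8 = b ^ 2 := by rw [hb]; ring
  have hab : a ≤ b := hb ▸ le_self_pow₀ (by linarith) (by norm_num)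
  have ha2b : a ^ 2 ≤ b := hb ▸ pow_le_pow_right₀ (by linarith) (by norm_num)
  have hb0 : 0 < b := by linarith
  rw [h8] at hmean hsieve
  rw [← hb]
  have hμ0 : 0 ≤ mainMean a := Finset.sum_nonneg fun _ _ => by positivity
  have hμ : 1 + mainMean a ≤ 2 * b ^ 2 := by nlinarith [(abs_le.1 hmean).2]
  have hθ : |t / b| = |t| / b := by rw [abs_div, abs_of_pos hb0]
  have hQ : ∀ q ∈ mainQ a, q.Prime := fun q hq => (mem_mainQ.1 hq).1
  have hY (i : ℕ × ℕ × ℕ) :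
      Complex.exp (t * mainY a (tripleVal sumPrimeFactors i) * Complex.I) =
      Complex.exp ((t / b * ((omegaIn (mainQ a) (tripleVal sumPrimeFactors i) : ℝ) -
        ∑ q ∈ mainQ a, (q : ℝ)⁻¹) : ℝ) * Complex.I) := by
    rw [mainY, ← hb]
    change _ = Complex.exp ((t / b * (_ - mainMean a) : ℝ) * Complex.I)
    congr 2
    push_cast
    ring
  simp only [hY]
  have h1 := norm_expect_exp_sub_model_le (s := mainTriples a) (b := tripleVal sumPrimeFactors) hQ
    (θ := t / b) (Λ := (2 * |t| + 1) / b) (by rw [div_le_one hb0]; linarith)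
    (by rw [hθ, div_div, div_le_div_iff₀ hb0 (by positivity)]; nlinarith) hk hk1
  have h2 := norm_expect_model_sub_le hQ (θ := t / b) (ε := exp (-a))
    (by rw [hθ, div_le_one hb0]; linarith) (fun q hq => by
      rw [Real.exp_neg]
      refine inv_anti₀ (exp_pos _) (le_trans (Real.exp_le_exp.2 ?_) (mem_mainQ.1 hq).2.1.le)
      rw [h8]
      nlinarith)
  refine (norm_sub_le_norm_sub_add_norm_sub _ _ _).trans (add_le_add (h1.trans ?_) (h2.trans ?_))
  · change _ * exp (|t / b| * (k * (1 + mainMean a))) + _ * exp (mainMean a * _) ≤ _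
    have h3 : exp (|t / b| * (k * (1 + mainMean a))) ≤ exp (2 * k * |t| * b) := by
      rw [Real.exp_le_exp, hθ]
      calc |t| / b * (k * (1 + mainMean a)) ≤ |t| / b * (k * (2 * b ^ 2)) := by gcongr
        _ = 2 * k * |t| * b := by field_simp
    have h4 : exp (mainMean a * ((2 * |t| + 1) / b) ^ 2) ≤ exp (2 * (2 * |t| + 1) ^ 2) := by
      rw [Real.exp_le_exp]
      calc mainMean a * ((2 * |t| + 1) / b) ^ 2 ≤ (2 * b ^ 2) * ((2 * |t| + 1) / b) ^ 2 := by
            gcongr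
            linarith
        _ = _ := by field_simp
    have h5 : a ^ 2 * exp (-b ^ 2) * exp (2 * k * |t| * b) ≤ exp (-a) := by
      calc a ^ 2 * exp (-b ^ 2) * exp (2 * k * |t| * b)
          ≤ exp b * exp (-b ^ 2) * exp (2 * k * |t| * b) := by
            gcongr
            linarith [Real.add_one_le_exp b]
        _ = exp (b - b ^ 2 + 2 * k * |t| * b) := by
            rw [← Real.exp_add, ← Real.exp_add]
            ring_nf
        _ ≤ exp (-a) := by
            rw [Real.exp_le_exp]
            nlinarith
    refine add_le_add ?_ (by gcongr)
    calc _ ≤ 96 * k * (a ^ 2 * exp (-b ^ 2)) * exp (2 * k * |t| * b) := by gcongr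
      _ = 96 * k * (a ^ 2 * exp (-b ^ 2) * exp (2 * k * |t| * b)) := by ring
      _ ≤ _ := by gcongr
  · change mainMean a * _ ≤ _
    rw [hθ]
    calc mainMean a * ((|t| / b) ^ 3 + 4 * (t / b) ^ 2 * exp (-a))
        ≤ (2 * b ^ 2) * ((|t| / b) ^ 3 + 4 * (t / b) ^ 2 * exp (-a)) := by
          gcongr
          linarith
      _ = 2 * |t| ^ 3 / b + 8 * t ^ 2 * exp (-a) := by
          field_simp
          ring
      _ ≤ _ := by gcongr

lemma tendsto_mainMean_div : Tendsto (fun a => mainMean a / a ^ 8) atTop (𝓝 1) := by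
  have hlim : Tendsto (fun a : ℝ => 1 / a ^ 6) atTop (𝓝 0) :=
    (tendsto_pow_atTop (by norm_num)).const_div_atTop 1
  rw [tendsto_iff_dist_tendsto_zero]
  refine squeeze_zero' (Eventually.of_forall fun _ => dist_nonneg) ?_ hlim
  filter_upwards [eventually_abs_mainMean_sub_le, eventually_gt_atTop 0] with a h ha
  have h8 : 0 < a ^ 8 := by positivity
  rw [Real.dist_eq, show mainMean a / a ^ 8 - 1 = (mainMean a - a ^ 8) / a ^ 8 by field_simp,
    abs_div, abs_of_pos h8, div_le_div_iff₀ h8 (by positivity)]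
  calc |mainMean a - a ^ 8| * a ^ 6 ≤ a ^ 2 * a ^ 6 := by gcongr
    _ = 1 * a ^ 8 := by ring

lemma tendsto_charFun_mainY (t : ℝ) :
    Tendsto (fun a => 𝔼 i ∈ mainTriples a,
      Complex.exp (t * mainY a (tripleVal sumPrimeFactors i) * Complex.I)) atTop
      (𝓝 (Complex.exp (-t ^ 2 / 2))) := by
  have hmodel : Tendsto (fun a => Complex.exp (-((t / a ^ 4) ^ 2 * mainMean a / 2 : ℝ))) atTop
      (𝓝 (Complex.exp (-t ^ 2 / 2))) := by
    have h : Tendsto (fun a => Complex.exp (-(t ^ 2 / 2 * (mainMean a / a ^ 8) : ℝ))) atTop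
        (𝓝 (Complex.exp (-(t ^ 2 / 2 * 1 : ℝ)))) :=
      ((Complex.continuous_exp.comp (continuous_neg.comp Complex.continuous_ofReal)).tendsto
        _).comp (tendsto_mainMean_div.const_mul _)
    have e : Complex.exp (-(t ^ 2 / 2 * 1 : ℝ)) = Complex.exp (-t ^ 2 / 2) := by
      congr 1
      push_cast
      ring
    rw [e] at h
    refine h.congr fun a => ?_
    congr 3
    ring
  have hdiff : Tendsto (fun a => (𝔼 i ∈ mainTriples a,
      Complex.exp (t * mainY a (tripleVal sumPrimeFactors i) * Complex.I)) -
        Complex.exp (-((t / a ^ 4) ^ 2 * mainMean a / 2 : ℝ))) atTop (𝓝 0) := by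
    rw [NormedAddGroup.tendsto_nhds_zero]
    intro ε hε
    have hgeom : Tendsto (fun j : ℕ => 4 * (1 / 2 : ℝ) ^ j * exp (2 * (2 * |t| + 1) ^ 2)) atTop
        (𝓝 (4 * 0 * exp (2 * (2 * |t| + 1) ^ 2))) :=
      ((tendsto_pow_atTop_nhds_zero_of_lt_one (by norm_num) (by norm_num)).const_mul 4).mul_const _
    obtain ⟨N, hN⟩ := eventually_atTop.1
      (hgeom.eventually_lt_const (u := ε / 2) (by simpa using half_pos hε))
    set k := 2 * (N + 1)
    have hexp : Tendsto (fun a : ℝ => exp (-a)) atTop (𝓝 0) :=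
      Real.tendsto_exp_neg_atTop_nhds_zero
    have hrest : Tendsto (fun a : ℝ => 96 * k * exp (-a) +
        (2 * |t| ^ 3 / a + 8 * t ^ 2 * exp (-a))) atTop
        (𝓝 (96 * k * 0 + (0 + 8 * t ^ 2 * 0))) :=
      (hexp.const_mul _).add ((tendsto_id.const_div_atTop _).add (hexp.const_mul _))
    filter_upwards [eventually_norm_charFun_sub_le t (even_two_mul (N + 1)) (by omega),
      hrest.eventually_lt_const (u := ε / 2) (by simpa using half_pos hε)] with a h1 h2
    have h3 := hN k (by omega)
    linarith
  simpa using hdiff.add hmodel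

lemma tendsto_card_mainY_le_div (v : ℝ) :
    Tendsto (fun a => (#((Icc 1 ⌊mainX a⌋₊).filter fun n =>
      mainY a (sumPrimeFactors n) ≤ v) : ℝ) / mainX a) atTop (𝓝 (gaussianCDF v)) := by
  have hne : ∀ᶠ a in atTop, (mainTriples a).Nonempty := by
    filter_upwards [eventually_le_card_mainTriples] with a ha
    have : 0 < mainX a := exp_pos _
    rw [← Finset.card_pos, ← Nat.cast_pos (α := ℝ)]
    linarith
  have h := tendsto_card_le_div_card hne tendsto_charFun_mainY v
  have hdiff : Tendsto (fun a => (#((Icc 1 ⌊mainX a⌋₊).filter fun n =>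
      mainY a (sumPrimeFactors n) ≤ v) : ℝ) / mainX a - (#((mainTriples a).filter fun i =>
      mainY a (tripleVal sumPrimeFactors i) ≤ v) : ℝ) / #(mainTriples a)) atTop (𝓝 0) := by
    refine squeeze_zero_norm' ?_ tendsto_mainError
    filter_upwards [eventually_ge_atTop 2, eventually_one_le_sum_mainI,
      tendsto_mainError.eventually_le_const (u := 1 / 2) (by norm_num)] with a ha hE herr
    exact abs_card_div_sub_card_div_le (Real.one_le_exp (exp_pos _).le) (by linarith)
      (fun p hp => mem_mainI_bounds hp) hE herr (fun n => mainY a n ≤ v)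
  simpa using hdiff.add h

end CharFun

end ErdosKac

namespace ErdosKac

section Transfer

open Finset Real
open scoped Topology

lemma eventually_card_medium_le {ε : ℝ} (hε : 0 < ε) {H : ℝ → ℝ} (hH : Tendsto H atTop atTop)
    (hle : ∀ᶠ a in atTop, H a ≤ a ^ 8) :
    ∀ᶠ a : ℝ in atTop, (#((Icc 1 ⌊mainX a⌋₊).filter fun n =>
      a ^ 2 ≤ (omegaIn (primesIoc (H a ^ 8) (exp (4 * H a))) (sumPrimeFactors n) : ℝ)) : ℝ) /
        mainX a ≤ ε := by
  filter_upwards [hH.eventually (eventually_card_le_omegaIn_le (half_pos hε)), hle,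
    hH.eventually_gt_atTop 0, eventually_ge_atTop 2, eventually_ge_atTop (32 / ε)]
    with a h hle hpos ha haε
  have ha0 : 0 < a := by linarith
  have hx : exp (H a ^ 2) ≤ mainX a := by
    rw [mainX, Real.exp_le_exp]
    have h16 : (16 : ℝ) ≤ a ^ 8 :=
      le_trans (by norm_num) (pow_le_pow_left₀ (by norm_num) ha 8)
    calc H a ^ 2 ≤ (a ^ 8) ^ 2 := by gcongr
      _ ≤ (a ^ 8) ^ 2 * (a ^ 8 / 16) ^ 2 :=
        le_mul_of_one_le_right (by positivity) (one_le_pow₀ (by linarith))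
      _ = (a ^ 8 / 4) ^ 4 := by ring
      _ ≤ exp (a ^ 8 / 4) ^ 4 := by
        gcongr
        linarith [Real.add_one_le_exp (a ^ 8 / 4)]
      _ = exp (a ^ 8) := by
        rw [← Real.exp_nat_mul]
        congr 1
        push_cast
        ring
  refine (h _ hx (a ^ 2) (by positivity)).trans ?_
  have hlog : log (H a) ≤ 8 * a := by
    refine (Real.log_le_log hpos hle).trans ?_
    rw [Real.log_pow]
    push_cast
    linarith [Real.log_le_sub_one_of_pos ha0]
  have h2 : 2 * log (H a) / a ^ 2 ≤ ε / 2 := by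
    rw [div_le_iff₀ (by positivity)]
    rw [div_le_iff₀ hε] at haε
    nlinarith
  linarith

lemma omegaIn_le_card_primeFactors {Q : Finset ℕ} (hQ : ∀ q ∈ Q, q.Prime) {N : ℕ} (hN : N ≠ 0) :
    omegaIn Q N ≤ #N.primeFactors := by
  refine Finset.card_le_card fun q hq => ?_
  obtain ⟨h1, h2⟩ := Finset.mem_filter.1 hq
  exact Nat.mem_primeFactors.2 ⟨hQ q h1, h2, hN⟩

/-- Counting prime factors by size. -/
lemma card_primeFactors_le (N : ℕ) {u₀ u₁ u₂ w : ℝ} (h₀ : 0 ≤ u₀) (h₁ : 0 ≤ u₁) (h₂ : 0 ≤ u₂)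
    (hw : 0 ≤ w) :
    (#N.primeFactors : ℝ) ≤ u₀ + 1 + omegaIn (primesIoc u₀ u₁) N + omegaIn (primesIoc u₁ u₂) N +
      omegaIn (primesIoc u₂ w) N + #(N.primeFactors.filter fun p : ℕ => w < p) := by
  have hsub : N.primeFactors ⊆ (((range (⌊u₀⌋₊ + 1) ∪ (primesIoc u₀ u₁).filter (· ∣ N)) ∪
      (primesIoc u₁ u₂).filter (· ∣ N)) ∪ (primesIoc u₂ w).filter (· ∣ N)) ∪
      N.primeFactors.filter fun p : ℕ => w < p := by
    intro p hp
    obtain ⟨h1, h2, -⟩ := Nat.mem_primeFactors.1 hp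
    simp only [Finset.mem_union, Finset.mem_filter, Finset.mem_range, mem_primesIoc h₀ h₁,
      mem_primesIoc h₁ h₂, mem_primesIoc h₂ hw, Nat.lt_succ_iff, Nat.le_floor_iff h₀]
    have c0 := le_or_gt (p : ℝ) u₀
    have c1 := le_or_gt (p : ℝ) u₁
    have c2 := le_or_gt (p : ℝ) u₂
    have c3 := le_or_gt (p : ℝ) w
    tauto
  have h := (Finset.card_le_card hsub).trans ((Finset.card_union_le _ _).trans
    (Nat.add_le_add_right ((Finset.card_union_le _ _).trans (Nat.add_le_add_right
    ((Finset.card_union_le _ _).trans (Nat.add_le_add_right (Finset.card_union_le _ _) _)) _)) _))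
  rw [Finset.card_range] at h
  have h' : (#N.primeFactors : ℝ) ≤ (⌊u₀⌋₊ + 1 : ℕ) + omegaIn (primesIoc u₀ u₁) N +
      omegaIn (primesIoc u₁ u₂) N + omegaIn (primesIoc u₂ w) N +
      #(N.primeFactors.filter fun p : ℕ => w < p) := by exact_mod_cast h
  push_cast at h'
  linarith [Nat.floor_le h₀]

/-- Few prime factors of the sum of the prime divisors of `n` lie above `mainQ a`. -/
lemma card_large_sumPrimeFactors_le {a : ℝ} (ha : 0 < a) {n : ℕ} (hn : 2 ≤ n)
    (hnx : (n : ℝ) ≤ mainX a) :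
    (#((sumPrimeFactors n).primeFactors.filter fun p : ℕ => exp (exp (a ^ 8) / a ^ 2) < p) : ℝ) ≤
      2 * a ^ 2 := by
  refine (card_large_primeFactors_le (sumPrimeFactors_pos hn).ne'
    (Real.one_lt_exp_iff.2 (by positivity))).trans ?_
  rw [Real.log_exp, div_le_iff₀ (by positivity)]
  have h0 : (0 : ℝ) < n := by exact_mod_cast (by omega : 0 < n)
  calc log (sumPrimeFactors n) ≤ log ((n : ℝ) ^ 2) :=
        Real.log_le_log (by exact_mod_cast sumPrimeFactors_pos hn)
          (by exact_mod_cast sumPrimeFactors_le n)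
    _ = 2 * log n := by rw [Real.log_pow]; norm_num
    _ ≤ 2 * log (mainX a) := by gcongr
    _ = 2 * a ^ 2 * (exp (a ^ 8) / a ^ 2) := by
      rw [mainX, Real.log_exp]
      field_simp

/-- The distribution function of the theorem, at the main scale. -/
lemma tendsto_card_sub_le_div (u : ℝ) :
    Tendsto (fun a : ℝ => (#((Icc 2 ⌊mainX a⌋₊).filter fun n =>
      (#(sumPrimeFactors n).primeFactors : ℝ) - a ^ 8 ≤ u * a ^ 4) : ℝ) / mainX a) atTop
      (𝓝 (gaussianCDF u)) := by
  have hcont (c : ℝ) : Tendsto (fun δ => gaussianCDF (u + c * δ)) (𝓝[>] 0) (𝓝 (gaussianCDF u)) := by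
    have h : Continuous fun δ => gaussianCDF (u + c * δ) :=
      continuous_gaussianCDF.comp (continuous_const.add (continuous_const.mul continuous_id))
    have := (h.tendsto 0).mono_left (nhdsWithin_le_nhds (s := Set.Ioi 0))
    rwa [mul_zero, add_zero] at this
  have hXpos (a : ℝ) : 0 < mainX a := exp_pos _
  have hpos (n a : ℕ) (h : n ∈ Icc 2 a) : sumPrimeFactors n ≠ 0 :=
    (sumPrimeFactors_pos (Finset.mem_Icc.1 h).1).ne'
  have hQ (a : ℝ) : ∀ q ∈ mainQ a, q.Prime := fun q hq => (mem_mainQ.1 hq).1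
  refine tendsto_order.2 ⟨fun b hb => ?_, fun b hb => ?_⟩
  · obtain ⟨δ, hδb, hδ⟩ := (((hcont (-1)).eventually_const_lt hb).and
      self_mem_nhdsWithin).exists
    replace hδ : 0 < δ := hδ
    obtain ⟨g, hg⟩ : ∃ g, g = gaussianCDF (u + -1 * δ) - b := ⟨_, rfl⟩
    have hg0 : 0 < g := by linarith
    have hX : Tendsto (fun a => 1 / mainX a) atTop (𝓝 0) :=
      (Real.tendsto_exp_atTop.comp (Real.tendsto_exp_atTop.comp
        (tendsto_pow_atTop (by norm_num)))).const_div_atTop 1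
    filter_upwards [eventually_card_medium_le (ε := g / 4) (by linarith)
        (tendsto_pow_atTop (n := 8) (by norm_num)) (Eventually.of_forall fun a => le_rfl),
      eventually_card_medium_le (ε := g / 4) (by linarith) (H := fun a => 16 * log a)
        (Real.tendsto_log_atTop.const_mul_atTop (by norm_num)) (by
          filter_upwards [eventually_ge_atTop 16] with a ha
          have h1 := Real.log_le_sub_one_of_pos (show 0 < a by linarith)
          calc 16 * log a ≤ a * a := by nlinarith
            _ = a ^ 2 := by ring
            _ ≤ a ^ 8 := pow_le_pow_right₀ (by linarith) (by norm_num)),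
      hX.eventually_lt_const (u := g / 4) (by linarith),
      (tendsto_card_mainY_le_div (u + -1 * δ)).eventually_const_lt
        (u := gaussianCDF (u + -1 * δ) - g / 4) (by linarith),
      eventually_abs_mainMean_sub_le, eventually_ge_atTop 2,
      eventually_ge_atTop ((16 ^ 8 + 7) / δ),
      (isLittleO_pow_log_id_atTop (n := 8)).bound one_pos] with a h1 h2 h3 h4 hmean ha haδ hlog
    have ha0 : 0 < a := by linarith
    have hloga : 0 ≤ log a := Real.log_nonneg (by linarith)
    have hpow : log a ^ 8 ≤ a := by
      rw [one_mul, Real.norm_of_nonneg (by positivity), id, Real.norm_of_nonneg ha0.le] at hlog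
      exact hlog
    have hcover : ((Icc 1 ⌊mainX a⌋₊).filter fun n => mainY a (sumPrimeFactors n) ≤ u + -1 * δ) ⊆
        (((Icc 2 ⌊mainX a⌋₊).filter fun n =>
          (#(sumPrimeFactors n).primeFactors : ℝ) - a ^ 8 ≤ u * a ^ 4) ∪
        (Icc 1 ⌊mainX a⌋₊).filter fun n =>
          a ^ 2 ≤ (omegaIn (primesIoc ((a ^ 8) ^ 8) (exp (4 * a ^ 8))) (sumPrimeFactors n) : ℝ)) ∪
        ((Icc 1 ⌊mainX a⌋₊).filter fun n =>
          a ^ 2 ≤ (omegaIn (primesIoc ((16 * log a) ^ 8) (exp (4 * (16 * log a))))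
            (sumPrimeFactors n) : ℝ)) ∪ {1} := by
      intro n hn
      obtain ⟨hnX, hnY⟩ := Finset.mem_filter.1 hn
      by_contra hcon
      simp only [Finset.mem_union, Finset.mem_filter, hnX, true_and, not_or, not_le,
        Finset.mem_singleton] at hcon
      obtain ⟨⟨⟨hc1, hc2⟩, hc3⟩, hc4⟩ := hcon
      obtain ⟨hn1, hnX⟩ := Finset.mem_Icc.1 hnX
      have hn2 : 2 ≤ n := by omega
      refine hc1 ⟨Finset.mem_Icc.2 ⟨hn2, hnX⟩, ?_⟩
      have hlarge := card_large_sumPrimeFactors_le ha0 hn2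
        ((Nat.cast_le.2 hnX).trans (Nat.floor_le (hXpos a).le))
      have hexp : exp (4 * (16 * log a)) = (a ^ 8) ^ 8 := by
        rw [← pow_mul, ← Real.exp_log (pow_pos ha0 (8 * 8)), Real.log_pow]
        congr 1
        push_cast
        ring
      rw [hexp] at hc3
      have hall := card_primeFactors_le (sumPrimeFactors n) (u₀ := (16 * log a) ^ 8)
        (u₁ := (a ^ 8) ^ 8) (u₂ := exp (4 * a ^ 8)) (w := exp (exp (a ^ 8) / a ^ 2))
        (by positivity) (by positivity) (exp_pos _).le (exp_pos _).le
      change _ ≤ _ + (omegaIn (mainQ a) (sumPrimeFactors n) : ℝ) + _ at hall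
      rw [mainY, div_le_iff₀ (by positivity)] at hnY
      have hmean := (abs_le.1 hmean).2
      have h16 : (16 * log a) ^ 8 ≤ 16 ^ 8 * a := by
        rw [mul_pow]
        gcongr
      have hfin : (16 ^ 8 + 7) * a ^ 2 ≤ δ * a ^ 4 := by
        rw [div_le_iff₀ hδ] at haδ
        have : a * a ^ 2 ≤ a ^ 4 := by
          calc a * a ^ 2 = a ^ 3 := by ring
            _ ≤ a ^ 4 := pow_le_pow_right₀ (by linarith) (by norm_num)
        calc (16 ^ 8 + 7) * a ^ 2 ≤ a * δ * a ^ 2 := by gcongr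
          _ = δ * (a * a ^ 2) := by ring
          _ ≤ δ * a ^ 4 := by gcongr
      have ha2 : a ≤ a ^ 2 := by nlinarith
      linarith
    have hcard := Nat.cast_le (α := ℝ).2 ((Finset.card_le_card hcover).trans
      ((Finset.card_union_le _ _).trans
        (Nat.add_le_add_right ((Finset.card_union_le _ _).trans
          (Nat.add_le_add_right (Finset.card_union_le _ _) _)) _)))
    have hdiv := div_le_div_of_nonneg_right hcard (hXpos a).le
    rw [Finset.card_singleton] at hdiv
    push_cast at hdiv
    rw [add_div, add_div, add_div] at hdiv
    linarith
  · obtain ⟨δ, hδb, hδ⟩ := (((hcont 1).eventually_lt_const hb).and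
      self_mem_nhdsWithin).exists
    replace hδ : 0 < δ := hδ
    filter_upwards [(tendsto_card_mainY_le_div (u + 1 * δ)).eventually_lt_const hδb,
      eventually_abs_mainMean_sub_le, eventually_ge_atTop 2, eventually_ge_atTop (1 / δ)]
      with a h hmean ha haδ
    refine lt_of_le_of_lt ?_ h
    have hX := hXpos a
    gcongr ?_ / _
    refine Nat.cast_le.2 (Finset.card_le_card fun n hn => ?_)
    obtain ⟨hn1, hn2⟩ := Finset.mem_filter.1 hn
    have hn3 := Finset.mem_Icc.1 hn1
    refine Finset.mem_filter.2 ⟨Finset.mem_Icc.2 ⟨by omega, hn3.2⟩, ?_⟩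
    rw [mainY, div_le_iff₀ (by positivity)]
    have h1 : (omegaIn (mainQ a) (sumPrimeFactors n) : ℝ) ≤ #(sumPrimeFactors n).primeFactors :=
      Nat.cast_le.2 (omegaIn_le_card_primeFactors (hQ a) (hpos n _ hn1))
    have h2 : a ^ 2 ≤ δ * a ^ 4 := by
      rw [div_le_iff₀ hδ] at haδ
      calc a ^ 2 = 1 * a ^ 2 := by ring
        _ ≤ (a * δ) * a ^ 2 := by gcongr
        _ = δ * a ^ 3 := by ring
        _ ≤ δ * a ^ 4 := by
          gcongr
          · linarith
          · norm_num
    linarith [(abs_le.1 hmean).1]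

end Transfer

end ErdosKac

/-- Erdős–Kac law for ω(β(n)), where β(n) = Σ_{p ∣ n} p is the sum of the distinct
prime divisors of n. -/
theorem erdosKac_sum_prime_divisors (u : ℝ) :
    Tendsto (fun x : ℝ =>
      (((Finset.Icc 2 ⌊x⌋₊).filter (fun n : ℕ =>
        ((((∑ p ∈ n.primeFactors, p).primeFactors.card : ℝ) : ℝ)) - Real.log (Real.log x)
          ≤ u * Real.sqrt (Real.log (Real.log x)))).card : ℝ) / x)
      atTop
      (nhds ((Real.sqrt (2 * Real.pi))⁻¹ * ∫ t in Set.Iic u, Real.exp (-t ^ 2 / 2))) := by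
  have hL : Tendsto (fun x : ℝ => Real.log (Real.log x)) atTop atTop :=
    Real.tendsto_log_atTop.comp Real.tendsto_log_atTop
  have ha : Tendsto (fun x : ℝ => Real.log (Real.log x) ^ (1 / 8 : ℝ)) atTop atTop :=
    (tendsto_rpow_atTop (by norm_num)).comp hL
  refine ((ErdosKac.tendsto_card_sub_le_div u).comp ha).congr' ?_
  filter_upwards [hL.eventually_gt_atTop 0, Real.tendsto_log_atTop.eventually_gt_atTop 0,
    eventually_gt_atTop 0] with x h0 h1 h2
  have h8 : (Real.log (Real.log x) ^ (1 / 8 : ℝ)) ^ 8 = Real.log (Real.log x) := by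
    rw [← Real.rpow_natCast, ← Real.rpow_mul h0.le]
    norm_num
  have h4 : (Real.log (Real.log x) ^ (1 / 8 : ℝ)) ^ 4 = Real.sqrt (Real.log (Real.log x)) := by
    rw [← Real.sqrt_sq (show 0 ≤ (Real.log (Real.log x) ^ (1 / 8 : ℝ)) ^ 4 by positivity)]
    exact congrArg _ ((pow_mul _ 4 2).symm.trans h8)
  have hX : ErdosKac.mainX (Real.log (Real.log x) ^ (1 / 8 : ℝ)) = x := by
    rw [ErdosKac.mainX, h8, Real.exp_log h1, Real.exp_log h2]
  simp only [Function.comp_apply, h8, h4, hX, ErdosKac.sumPrimeFactors]
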